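/- arXiv:1710.03931 — 2 statements merged into one kernel-verified Lean document; each statement's English description precedes it below -/
import Mathlib

section
/- Let D ⊇ G be rooted digraphs with root r. If for every edge uv ∈ D∖G there is an I ∈ G_G(v) such that I ∪ {uv} ∉ G_{G+uv}(v), then every G-vertex-large H ⊆ G is also D-vertex-large. -/
namespace FlamePaper

universe u
variable {V : Type u}

/-- A (nonempty, repetition-free) directed path, given by the list of its vertices;
its edge set consists of the pairs of consecutive vertices. A one-vertex list is the
trivial `v→v` path. -/
structure DiPath (V : Type u) where
  verts : List V
  ne : verts ≠ []
  nodup : verts.Nodup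

namespace DiPath
variable (P : DiPath V)
def first : V := P.verts.head P.ne
def last : V := P.verts.getLast P.ne
def vertexSet : Set V := {x | x ∈ P.verts}
def edges : Set (V × V) := {e | e ∈ P.verts.zip P.verts.tail}
def internal : Set V := P.vertexSet \ {P.first, P.last}
/-- The last edge of `P` (as a set; empty for the trivial path). -/
def lastEdge : Set (V × V) := {e ∈ P.edges | e.2 = P.last}
end DiPath

/-- `P` is a path of the digraph `D`. -/
def IsPathIn (D : Set (V × V)) (P : DiPath V) : Prop := P.edges ⊆ D

/-- `P` is an `a→b` path in `D`. -/
def IsPath (D : Set (V × V)) (a b : V) (P : DiPath V) : Prop :=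
  IsPathIn D P ∧ P.first = a ∧ P.last = b

/-- The set of ingoing edges of `v` in `D`. -/
def inEdges (D : Set (V × V)) (v : V) : Set (V × V) := {e ∈ D | e.2 = v}

/-- The set of outgoing edges of `v` in `D`. -/
def outEdges (D : Set (V × V)) (v : V) : Set (V × V) := {e ∈ D | e.1 = v}

/-- A rooted digraph: the root has no ingoing edges. -/
def IsRooted (D : Set (V × V)) (r : V) : Prop := inEdges D r = ∅

/-- `Ps` is a system of internally disjoint `r→v` paths in `D`: any two distinct
members share exactly the vertices `r` and `v`. -/
def IntDisjSystem (D : Set (V × V)) (r v : V) (Ps : Set (DiPath V)) : Prop :=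
  (∀ P ∈ Ps, IsPath D r v P) ∧
  ∀ P ∈ Ps, ∀ Q ∈ Ps, P ≠ Q → P.vertexSet ∩ Q.vertexSet = {r, v}

/-- `A_last(Ps)`: the set of last edges of the paths in `Ps`. -/
def lastEdges (Ps : Set (DiPath V)) : Set (V × V) := ⋃ P ∈ Ps, P.lastEdge

/-- `𝒢_D(v)`: the set of those `I ⊆ in_D(v)` which arise as the set of last edges
of a system of internally disjoint `r→v` paths of `D`. -/
def GSet (D : Set (V × V)) (r v : V) : Set (Set (V × V)) :=
  {I | ∃ Ps, IntDisjSystem D r v Ps ∧ lastEdges Ps = I}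

/-- `Ps ∈ ℑ_D(v)`: an internally disjoint system of `r→v` paths of `D` from each member
of which one can choose either an internal vertex or an edge so that the resulting set
meets every `r→v` path of `D`. -/
def EMSystem (D : Set (V × V)) (r v : V) (Ps : Set (DiPath V)) : Prop :=
  IntDisjSystem D r v Ps ∧
  ∃ sel : DiPath V → V ⊕ (V × V),
    (∀ P ∈ Ps, (∀ x, sel P = Sum.inl x → x ∈ P.internal) ∧
              (∀ e, sel P = Sum.inr e → e ∈ P.edges)) ∧
    ∀ Q : DiPath V, IsPath D r v Q →
      ∃ P ∈ Ps, (∀ x, sel P = Sum.inl x → x ∈ Q.vertexSet) ∧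
               (∀ e, sel P = Sum.inr e → e ∈ Q.edges)

/-- The path-system `Ps` lies in `L`. -/
def LiesIn (Ps : Set (DiPath V)) (L : Set (V × V)) : Prop := ∀ P ∈ Ps, IsPathIn L P

/-- `L` is a `D`-vertex-large spanning subdigraph of `D`. -/
def IsLarge (D L : Set (V × V)) (r : V) : Prop :=
  L ⊆ D ∧ ∀ v, v ≠ r → ∃ Ps, EMSystem D r v Ps ∧ LiesIn Ps L

/-- `F` is a vertex-flame with root `r`. -/
def IsFlame (F : Set (V × V)) (r : V) : Prop :=
  ∀ v, v ≠ r → inEdges F v ∈ GSet F r v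

/-- `F` is a quasi-vertex-flame with root `r`. -/
def IsQuasiFlame (F : Set (V × V)) (r : V) : Prop :=
  ∀ v, v ≠ r → ∀ I ⊆ inEdges F v, I.Finite → I ∈ GSet F r v

/-- `S` separates `b` from `a` in `D`: every `a→b` path of `D` meets `S`. -/
def Separates (D : Set (V × V)) (a b : V) (S : Set V) : Prop :=
  ∀ P : DiPath V, IsPath D a b P → (P.vertexSet ∩ S).Nonempty

/-- `𝔖_D(v)`: the Erdős–Menger separations corresponding to `v`. -/
def SepSet (D : Set (V × V)) (r v : V) : Set (Set V) :=
  {S | r ∉ S ∧ v ∉ S ∧ Separates (D \ {(r, v)}) r v S ∧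
    ∃ Ps, IntDisjSystem D r v Ps ∧
      ∃ sel : DiPath V → V, (∀ P ∈ Ps, sel P ∈ P.internal) ∧ S = sel '' Ps}

/-- The entrance of `X` with respect to `D`. -/
def entrance (D : Set (V × V)) (X : Set V) : Set V :=
  {v ∈ X | ∃ u, u ∉ X ∧ (u, v) ∈ D}

/-- `int_D(X) = X ∖ ent_D(X)`. -/
def interiorSet (D : Set (V × V)) (X : Set V) : Set V := X \ entrance D X

/-- `B` is a `v`-bubble of `D` (with root `r`): `B ⊆ V − r` and there is a `v`-infan
`{P_u : u ∈ ent_D(B)}` in `D ∩ (B × B)` where `P_u` starts at `u`. -/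
def IsBubble (D : Set (V × V)) (r v : V) (B : Set V) : Prop :=
  r ∉ B ∧
  ∃ F : V → DiPath V,
    (∀ u ∈ entrance D B, IsPath (D ∩ B ×ˢ B) u v (F u)) ∧
    ∀ u ∈ entrance D B, ∀ u' ∈ entrance D B, u ≠ u' →
      (F u).vertexSet ∩ (F u').vertexSet = {v}

/-- `bubb_D(v)`. -/
def bubbles (D : Set (V × V)) (r v : V) : Set (Set V) := {B | IsBubble D r v B}

/-- `B_{v,D}`: the union of all `v`-bubbles of `D`. -/
def maxBubble (D : Set (V × V)) (r v : V) : Set V := ⋃₀ bubbles D r v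

/-- `B_{S,v,D}`: the set of vertices `u` such that every `r→u` path of `D−rv` meets `S`. -/
def Bset (D : Set (V × V)) (r v : V) (S : Set V) : Set V :=
  {u | ∀ P : DiPath V, IsPath (D \ {(r, v)}) r u P → (P.vertexSet ∩ S).Nonempty}

/-- `Ps` is an `r`-fan in `D`: paths of `D` starting at `r`, any two distinct members
having only the vertex `r` in common. -/
def IsRFan (D : Set (V × V)) (r : V) (Ps : Set (DiPath V)) : Prop :=
  (∀ P ∈ Ps, IsPathIn D P ∧ P.first = r) ∧
  ∀ P ∈ Ps, ∀ Q ∈ Ps, P ≠ Q → P.vertexSet ∩ Q.vertexSet = {r}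

/-- The set of first vertices of the paths in `Ps`. -/
def Vfirst (Ps : Set (DiPath V)) : Set V := DiPath.first '' Ps

/-- The set of last vertices of the paths in `Ps`. -/
def Vlast (Ps : Set (DiPath V)) : Set V := DiPath.last '' Ps

/-- `P` is an `X→Y` path in `D`: exactly its first vertex lies in `X` and
exactly its last vertex lies in `Y`. -/
def IsXYPath (D : Set (V × V)) (X Y : Set V) (P : DiPath V) : Prop :=
  IsPathIn D P ∧ P.vertexSet ∩ X = {P.first} ∧ P.vertexSet ∩ Y = {P.last}

/-- `Ps` is a system of pairwise (vertex-)disjoint `X→Y` paths of `D`. -/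
def DisjXYSystem (D : Set (V × V)) (X Y : Set V) (Ps : Set (DiPath V)) : Prop :=
  (∀ P ∈ Ps, IsXYPath D X Y P) ∧
  ∀ P ∈ Ps, ∀ Q ∈ Ps, P ≠ Q → P.vertexSet ∩ Q.vertexSet = ∅

/-- `κ_D(r,v)`: the maximum size of a (finite) system of internally disjoint `r→v`
paths of `D`. -/
noncomputable def kappa (D : Set (V × V)) (r v : V) : ℕ :=
  sSup {n : ℕ | ∃ Ps : Set (DiPath V), IntDisjSystem D r v Ps ∧ Ps.Finite ∧ Ps.ncard = n}

section Lists

variable {α : Type u}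

theorem eq_of_append_cons_eq {B : Set α} {p p' q q' : List α} {b b' : α}
    (h : p ++ b :: q = p' ++ b' :: q') (hp : ∀ w ∈ p, w ∉ B) (hp' : ∀ w ∈ p', w ∉ B)
    (hb : b ∈ B) (hb' : b' ∈ B) : p = p' ∧ b = b' ∧ q = q' := by
  induction p generalizing p' with
  | nil =>
    cases p' with
    | nil => simpa using h
    | cons c p' =>
      simp only [List.nil_append, List.cons_append, List.cons.injEq] at h
      exact absurd hb (h.1 ▸ hp' c (by simp))
  | cons c p ih =>
    cases p' with
    | nil =>
      simp only [List.nil_append, List.cons_append, List.cons.injEq] at h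
      exact absurd hb' (h.1 ▸ hp c (by simp))
    | cons c' p' =>
      simp only [List.cons_append, List.cons.injEq] at h
      obtain ⟨h1, h2⟩ := h
      obtain ⟨h3, h4⟩ := ih h2 (fun w hw => hp w (by simp [hw])) (fun w hw => hp' w (by simp [hw]))
      exact ⟨by rw [h1, h3], h4⟩

theorem eq_of_append_cons_eq_of_nodup {p p' q q' : List α} {b : α}
    (h : p ++ b :: q = p' ++ b :: q') (hn : (p ++ b :: q).Nodup) : p = p' ∧ q = q' := by
  have h1 : ∀ w ∈ p, w ∉ ({b} : Set α) := by
    rintro w hw rfl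
    simp [List.nodup_append] at hn
    grind
  have h2 : ∀ w ∈ p', w ∉ ({b} : Set α) := by
    rintro w hw rfl
    rw [h] at hn
    simp [List.nodup_append] at hn
    grind
  obtain ⟨h3, -, h4⟩ := eq_of_append_cons_eq h h1 h2 rfl rfl
  exact ⟨h3, h4⟩

theorem exists_first_entry {B : Set α} {l : List α} {a : α} (hl : l.head? = some a)
    (ha : a ∉ B) (h : ∃ z ∈ l, z ∈ B) :
    ∃ k c d k', l = k ++ c :: d :: k' ∧ (∀ w ∈ k ++ [c], w ∉ B) ∧ d ∈ B := by
  induction l generalizing a with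
  | nil => simp at hl
  | cons x l ih =>
    obtain rfl : x = a := by simpa using hl
    cases l with
    | nil => simp at h; contradiction
    | cons y l =>
      by_cases hy : y ∈ B
      · exact ⟨[], x, y, l, by simp, by simpa using ha, hy⟩
      · obtain ⟨k, c, d, k', h1, h2, h3⟩ := ih (a := y) (by simp) hy (by
          obtain ⟨z, hz, hzB⟩ := h
          refine ⟨z, ?_, hzB⟩
          rcases List.mem_cons.1 hz with rfl | hz
          · contradiction
          · exact hz)
        refine ⟨x :: k, c, d, k', by simp [h1], ?_, h3⟩
        intro w hw
        rcases List.mem_cons.1 hw with rfl | hw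
        · exact ha
        · exact h2 w hw

theorem exists_last_entry {B : Set α} {l : List α} {b : α} (hb : l.getLast? = some b)
    (hbB : b ∈ B) (hl : ∃ w ∈ l, w ∉ B) :
    ∃ k c d k', l = k ++ c :: d :: k' ∧ c ∉ B ∧ ∀ w ∈ d :: k', w ∈ B := by
  induction l with
  | nil => simp at hb
  | cons x l ih =>
    cases l with
    | nil => simp at hb; subst hb; simp at hl; contradiction
    | cons y l =>
      by_cases hy : ∃ w ∈ y :: l, w ∉ B
      · obtain ⟨k, c, d, k', h1, h2, h3⟩ := ih (by simpa using hb) hy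
        exact ⟨x :: k, c, d, k', by simp [h1], h2, h3⟩
      · push Not at hy
        obtain ⟨w, hw, hwB⟩ := hl
        rcases List.mem_cons.1 hw with rfl | hw
        · exact ⟨[], w, y, l, by simp, hwB, hy⟩
        · exact absurd (hy w hw) hwB

theorem mem_zip_tail_iff {l : List α} {a b : α} :
    (a, b) ∈ l.zip l.tail ↔ ∃ p q, l = p ++ a :: b :: q := by
  induction l with
  | nil => simp
  | cons x l ih =>
    cases l with
    | nil =>
      simp only [List.tail_cons, List.zip_nil_right, List.not_mem_nil, false_iff]
      rintro ⟨p, q, h⟩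
      have := congrArg List.length h
      simp at this
      omega
    | cons y l =>
      simp only [List.tail_cons, List.zip_cons_cons, List.mem_cons, Prod.mk.injEq] at ih ⊢
      rw [ih]
      constructor
      · rintro (⟨rfl, rfl⟩ | ⟨p, q, h⟩)
        · exact ⟨[], l, rfl⟩
        · exact ⟨x :: p, q, by rw [h]; rfl⟩
      · rintro ⟨p, q, h⟩
        cases p with
        | nil => left; simp at h; grind
        | cons z p =>
          right
          simp at h
          exact ⟨p, q, h.2⟩

/-- `l` lists the vertices of an `a→b` path along the relation `R`. -/
structure IsPathList (R : α → α → Prop) (a b : α) (l : List α) : Prop where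
  chain : l.IsChain R
  nodup : l.Nodup
  head : l.head? = some a
  last : l.getLast? = some b

namespace IsPathList

variable {R : α → α → Prop} {a b : α} {l : List α}

theorem rel_of_eq (h : IsPathList R a b l) {p q : List α} {c d : α} (e : l = p ++ c :: d :: q) :
    R c d :=
  List.isChain_iff_forall_rel_of_append_cons_cons.1 h.chain e

theorem head_mem (h : IsPathList R a b l) : a ∈ l := List.mem_of_head? h.head

theorem last_mem (h : IsPathList R a b l) : b ∈ l := List.mem_of_getLast? h.last

theorem take (h : IsPathList R a b l) {p q : List α} {c : α} (e : l = p ++ c :: q) :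
    IsPathList R a c (p ++ [c]) := by
  have e' : l = (p ++ [c]) ++ q := by simp [e]
  refine ⟨?_, ?_, ?_, by simp⟩
  · have := h.chain; rw [e'] at this; exact this.left_of_append
  · have := h.nodup; rw [e'] at this; exact this.of_append_left
  · have := h.head; rw [e] at this; cases p <;> simpa using this

theorem drop (h : IsPathList R a b l) {p q : List α} {c : α} (e : l = p ++ c :: q) :
    IsPathList R c b (c :: q) := by
  refine ⟨?_, ?_, by simp, ?_⟩
  · have := h.chain; rw [e] at this; exact this.right_of_append
  · have := h.nodup; rw [e] at this; exact this.of_append_right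
  · have := h.last; rw [e] at this; simpa using this

theorem eq_nil_of_last (h : IsPathList R a b l) {p q : List α} (e : l = p ++ b :: q) :
    q = [] := by
  by_contra hq
  have h1 := h.last
  rw [e, List.getLast?_append_of_ne_nil _ (by simp), List.getLast?_cons_of_ne_nil hq] at h1
  have := List.mem_of_getLast? h1
  have hn := h.nodup
  rw [e] at hn
  simp [List.nodup_append] at hn
  grind

theorem eq_nil_of_head (h : IsPathList R a b l) {p q : List α} (e : l = p ++ a :: q) :
    p = [] := by
  by_contra hq
  have h1 := h.head
  rw [e, List.head?_append_of_ne_nil _ hq] at h1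
  have := List.mem_of_head? h1
  have hn := h.nodup
  rw [e] at hn
  simp [List.nodup_append] at hn
  grind

/-- Concatenation of two disjoint path lists joined by an edge. -/
theorem append {c d : α} {m : List α} (h : IsPathList R a b l) (h' : IsPathList R c d m)
    (hbc : R b c) (hd : ∀ w ∈ l, w ∉ m) : IsPathList R a d (l ++ m) := by
  refine ⟨?_, ?_, ?_, ?_⟩
  · rw [List.isChain_append]
    refine ⟨h.chain, h'.chain, ?_⟩
    rw [h.last, h'.head]
    simpa using hbc
  · rw [List.nodup_append]
    exact ⟨h.nodup, h'.nodup, fun x hx y hy e => hd x hx (e ▸ hy)⟩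
  · rw [List.head?_append, h.head]; rfl
  · rw [List.getLast?_append, h'.last]; rfl

theorem mono {S : α → α → Prop} (h : IsPathList R a b l) (hRS : ∀ c d, R c d → S c d) :
    IsPathList S a b l :=
  ⟨h.chain.imp hRS, h.nodup, h.head, h.last⟩

theorem singleton (R : α → α → Prop) (a : α) : IsPathList R a a [a] :=
  ⟨by simp, by simp, by simp, by simp⟩

theorem snoc {c : α} (h : IsPathList R a b l) (hbc : R b c) (hc : c ∉ l) :
    IsPathList R a c (l ++ [c]) :=
  h.append (singleton R c) hbc (by grind)

theorem reflTransGen (h : IsPathList R a b l) {c : α} (hc : c ∈ l) :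
    Relation.ReflTransGen R a c := by
  induction l using List.reverseRecOn generalizing b c with
  | nil => simp at hc
  | append_singleton l x ih =>
    rcases List.eq_nil_or_concat l with rfl | ⟨l', y, rfl⟩
    · have := h.head
      simp at this hc
      subst this hc
      exact .refl
    · have hy : R y x := h.rel_of_eq (p := l') (q := []) (by simp)
      have ht : IsPathList R a y (l' ++ [y]) := h.take (q := [x]) (by simp)
      rw [List.concat_eq_append] at *
      rcases List.mem_append.1 hc with hc | hc
      · exact ih ht hc
      · obtain rfl : c = x := by simpa using hc
        exact (ih ht (c := y) (by simp)).tail hy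

end IsPathList

theorem exists_isPathList {R : α → α → Prop} {a b : α} (h : Relation.ReflTransGen R a b) :
    ∃ l, IsPathList R a b l := by
  induction h with
  | refl => exact ⟨[a], .singleton R a⟩
  | @tail b c _ hbc ih =>
    obtain ⟨l, hl⟩ := ih
    by_cases hc : c ∈ l
    · obtain ⟨p, q, e⟩ := List.mem_iff_append.1 hc
      exact ⟨_, hl.take e⟩
    · exact ⟨_, hl.snoc hbc hc⟩

end Lists

theorem mem_edges_iff {P : DiPath V} {a b : V} :
    (a, b) ∈ P.edges ↔ ∃ p q, P.verts = p ++ a :: b :: q :=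
  mem_zip_tail_iff

/-- Adjacency in the digraph `D`. -/
def Adj (D : Set (V × V)) (a b : V) : Prop := (a, b) ∈ D

theorem isPath_iff {D : Set (V × V)} {a b : V} {P : DiPath V} :
    IsPath D a b P ↔ IsPathList (Adj D) a b P.verts := by
  constructor
  · rintro ⟨h, rfl, rfl⟩
    refine ⟨?_, P.nodup, List.head?_eq_some_head P.ne, List.getLast?_eq_some_getLast P.ne⟩
    rw [List.isChain_iff_forall_rel_of_append_cons_cons]
    intro a b p q e
    exact h (mem_edges_iff.2 ⟨p, q, e⟩)
  · intro h
    refine ⟨?_, ?_, ?_⟩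
    · rintro ⟨a, b⟩ he
      obtain ⟨p, q, e⟩ := mem_edges_iff.1 he
      exact h.rel_of_eq e
    · have := h.head
      rw [List.head?_eq_some_head P.ne] at this
      exact Option.some_injective _ this
    · have := h.last
      rw [List.getLast?_eq_some_getLast P.ne] at this
      exact Option.some_injective _ this

/-- The path with a given list of vertices. -/
def IsPathList.toDiPath {R : V → V → Prop} {a b : V} {l : List V} (h : IsPathList R a b l) :
    DiPath V :=
  ⟨l, List.ne_nil_of_mem h.head_mem, h.nodup⟩

theorem DiPath.ext {P Q : DiPath V} (h : P.verts = Q.verts) : P = Q := by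
  cases P; cases Q; simp at h; subst h; rfl

theorem mem_lastEdge_iff {D : Set (V × V)} {a b : V} {P : DiPath V} (h : IsPath D a b P)
    {c d : V} : (c, d) ∈ P.lastEdge ↔ d = b ∧ ∃ p, P.verts = p ++ [c, b] := by
  have h' := isPath_iff.1 h
  simp only [DiPath.lastEdge, Set.mem_ofPred_eq, mem_edges_iff, h.2.2]
  constructor
  · rintro ⟨⟨p, q, e⟩, rfl⟩
    obtain rfl := h'.eq_nil_of_last (p := p ++ [c]) (q := q) (by simp [e])
    exact ⟨rfl, p, e⟩
  · rintro ⟨rfl, p, e⟩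
    exact ⟨⟨p, [], e⟩, rfl⟩

/-- Paths with a common final segment of length at least two have the same last edge. -/
theorem lastEdge_eq {D D' : Set (V × V)} {a b a' b' : V} {P Q : DiPath V} (hP : IsPath D a b P)
    (hQ : IsPath D' a' b' Q) {X Z Y : List V} (eP : P.verts = X ++ Y) (eQ : Q.verts = Z ++ Y)
    (hY : 2 ≤ Y.length) : P.lastEdge = Q.lastEdge := by
  obtain ⟨Y', c, d, rfl⟩ : ∃ Y' c d, Y = Y' ++ [c, d] := by
    rcases List.eq_nil_or_concat Y with rfl | ⟨Y1, d, rfl⟩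
    · simp at hY
    · rcases List.eq_nil_or_concat Y1 with rfl | ⟨Y2, c, rfl⟩
      · simp at hY
      · exact ⟨Y2, c, d, by simp⟩
  have hb : d = b := by
    have := (isPath_iff.1 hP).last; rw [eP] at this; simpa using this
  have hb' : d = b' := by
    have := (isPath_iff.1 hQ).last; rw [eQ] at this; simpa using this
  subst hb hb'
  ext ⟨s, t⟩
  rw [mem_lastEdge_iff hP, mem_lastEdge_iff hQ, eP, eQ]
  refine and_congr_right fun _ => ?_
  have key : ∀ W : List V, (∃ p, W ++ (Y' ++ [c, d]) = p ++ [s, d]) ↔ s = c := by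
    intro W
    constructor
    · rintro ⟨p, e⟩
      have := congrArg List.reverse e
      simp at this
      exact this.1.symm
    · rintro rfl
      exact ⟨W ++ Y', by simp⟩
  rw [key, key]

section Augmentation

/-- The vertices other than `y` reachable from `r` by alternating walks with respect to `Qs`
which make at most `n` steps. -/
def reachStage (G : Set (V × V)) (r y : V) (Qs : Set (DiPath V)) : ℕ → Set V
  | 0 => {r}
  | n + 1 => reachStage G r y Qs n ∪
      {b | b ≠ y ∧ (∀ Q ∈ Qs, b ∉ Q.verts) ∧ ∃ a ∈ reachStage G r y Qs n, (a, b) ∈ G} ∪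
      {z | ∃ a ∈ reachStage G r y Qs n, ∃ Q ∈ Qs, ∃ p b q,
        Q.verts = p ++ b :: q ∧ z ∈ p ∧ b ≠ y ∧ (a, b) ∈ G}

/-- A rerouting of the system `Qs` of `r→y` paths inside `N` together with an additional path `A`
from `r` to `w`: a path `Q = Z Q ++ Y Q` becomes `X Q ++ Y Q`. -/
structure IsRerouting (G : Set (V × V)) (r y : V) (Qs : Set (DiPath V)) (N : Set V) (w : V)
    (X Y Z : DiPath V → List V) (A : List V) : Prop where
  isPathList_extra : IsPathList (Adj G) r w A
  extra_subset : ∀ c ∈ A, c ∈ N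
  isPathList : ∀ Q ∈ Qs, IsPathList (Adj G) r y (X Q ++ Y Q)
  verts_eq : ∀ Q ∈ Qs, Q.verts = Z Q ++ Y Q
  two_le_length : ∀ Q ∈ Qs, 2 ≤ (Y Q).length
  new_subset : ∀ Q ∈ Qs, ∀ c ∈ X Q, c ∈ N
  old_subset : ∀ Q ∈ Qs, ∀ c ∈ Z Q, c ∈ N
  disjoint_extra : ∀ Q ∈ Qs, ∀ c ∈ A, c ∈ X Q ++ Y Q → c = r
  disjoint : ∀ Q ∈ Qs, ∀ Q' ∈ Qs, Q ≠ Q' → ∀ c ∈ X Q ++ Y Q, c ∈ X Q' ++ Y Q' → c = r ∨ c = y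

variable {G : Set (V × V)} {r y : V} {Qs : Set (DiPath V)}

theorem not_mem_reachStage (hQs : IntDisjSystem G r y Qs) (hy : y ≠ r) (n : ℕ) :
    y ∉ reachStage G r y Qs n := by
  induction n with
  | zero => simpa [reachStage] using hy
  | succ n ih =>
    rintro ((h | h) | h)
    · exact ih h
    · exact h.1 rfl
    · obtain ⟨a, -, Q, hQ, p, b, q, e, hp, -, -⟩ := h
      obtain ⟨s, t, rfl⟩ := List.mem_iff_append.1 hp
      have := (isPath_iff.1 (hQs.1 Q hQ)).eq_nil_of_last (p := s) (q := t ++ b :: q) (by simp [e])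
      simp at this

theorem IsRerouting.mono {N N' : Set V} {w : V} {X Y Z : DiPath V → List V} {A : List V}
    (h : IsRerouting G r y Qs N w X Y Z A) (hN : N ⊆ N') : IsRerouting G r y Qs N' w X Y Z A :=
  { h with
    extra_subset := fun c hc => hN (h.extra_subset c hc)
    new_subset := fun Q hQ c hc => hN (h.new_subset Q hQ c hc)
    old_subset := fun Q hQ c hc => hN (h.old_subset Q hQ c hc) }

open Classical in
theorem exists_isRerouting (hQs : IntDisjSystem G r y Qs) (hy : y ≠ r) (n : ℕ) :
    ∀ w ∈ reachStage G r y Qs n, ∃ X Y Z A,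
      IsRerouting G r y Qs (reachStage G r y Qs n) w X Y Z A := by
  have hdisj : ∀ Q ∈ Qs, ∀ Q' ∈ Qs, Q ≠ Q' → ∀ c ∈ Q.verts, c ∈ Q'.verts → c = r ∨ c = y := by
    intro Q hQ Q' hQ' hne c hc hc'
    have : c ∈ Q.vertexSet ∩ Q'.vertexSet := ⟨hc, hc'⟩
    rw [hQs.2 Q hQ Q' hQ' hne] at this
    simpa using this
  have hpath : ∀ Q ∈ Qs, IsPathList (Adj G) r y Q.verts := fun Q hQ => isPath_iff.1 (hQs.1 Q hQ)
  have hyN := not_mem_reachStage hQs hy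
  induction n with
  | zero =>
    intro w hw
    obtain rfl : w = r := hw
    refine ⟨fun _ => [], DiPath.verts, fun _ => [], [w], .singleton _ _, ?_, by simpa using hpath,
      by simp, ?_, by simp, by simp, by simp, by simpa using hdisj⟩
    · simp [reachStage]
    · intro Q hQ
      have h1 := (hpath Q hQ).head
      have h2 := (hpath Q hQ).last
      by_contra hlt
      rcases hv : Q.verts with _ | ⟨a, _ | ⟨b, l⟩⟩
      · exact Q.ne hv
      · simp [hv] at h1 h2
        exact hy (h2.symm.trans h1)
      · simp [hv] at hlt
  | succ n ih =>
    have hsub : reachStage G r y Qs n ⊆ reachStage G r y Qs (n + 1) := fun c hc => .inl (.inl hc)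
    intro w hw
    by_cases hwn : w ∈ reachStage G r y Qs n
    · obtain ⟨X, Y, Z, A, h⟩ := ih w hwn
      exact ⟨X, Y, Z, A, h.mono hsub⟩
    have hw' := hw
    rcases hw with (hw | ⟨hwy, hwQ, a, ha, haw⟩) | ⟨a, ha, Q₀, hQ₀, p, b, q, e, hwp, hby, hab⟩
    · contradiction
    · obtain ⟨X, Y, Z, A, h⟩ := ih a ha
      refine ⟨X, Y, Z, A ++ [w], { h.mono hsub with
        isPathList_extra := h.isPathList_extra.snoc haw fun hwA => hwn (h.extra_subset w hwA)
        extra_subset := ?_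
        disjoint_extra := ?_ }⟩
      · intro c hc
        rcases List.mem_append.1 hc with hc | hc
        · exact hsub (h.extra_subset c hc)
        · obtain rfl : c = w := by simpa using hc
          exact hw'
      · intro Q hQ c hc hcQ
        rcases List.mem_append.1 hc with hc | hc
        · exact h.disjoint_extra Q hQ c hc hcQ
        · obtain rfl : c = w := by simpa using hc
          rcases List.mem_append.1 hcQ with hcQ | hcQ
          · exact absurd (h.new_subset Q hQ c hcQ) hwn
          · exact absurd (by simp [h.verts_eq Q hQ, hcQ]) (hwQ Q hQ)
    · obtain ⟨X, Y, Z, A, h⟩ := ih a ha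
      have hpN : ∀ c ∈ p, c ∈ reachStage G r y Qs (n + 1) :=
        fun c hc => .inr ⟨a, ha, Q₀, hQ₀, p, b, q, e, hc, hby, hab⟩
      obtain ⟨p', rfl, hY⟩ : ∃ p', p = Z Q₀ ++ p' ∧ Y Q₀ = p' ++ b :: q := by
        have e' := h.verts_eq Q₀ hQ₀
        rw [e, List.append_eq_append_iff] at e'
        rcases e' with ⟨m, h1, h2⟩ | ⟨m, h1, h2⟩
        · refine absurd (h.old_subset Q₀ hQ₀ w ?_) hwn
          rw [h1]; simp [hwp]
        · exact ⟨m, h1, h2⟩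
      have hwp' : w ∈ p' := by
        rcases List.mem_append.1 hwp with hc | hc
        · exact absurd (h.old_subset Q₀ hQ₀ w hc) hwn
        · exact hc
      obtain ⟨s, t, rfl⟩ := List.mem_iff_append.1 hwp'
      have hL := h.isPathList Q₀ hQ₀
      rw [hY] at hL
      have hnew : IsPathList (Adj G) r w (X Q₀ ++ s ++ [w]) :=
        hL.take (q := t ++ b :: q) (by simp)
      have htail : IsPathList (Adj G) b y (b :: q) :=
        hL.drop (p := X Q₀ ++ (s ++ w :: t)) (by simp)
      have hrb : r ∉ b :: q := by
        intro hr
        obtain ⟨s', t', e'⟩ := List.mem_iff_append.1 hr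
        have := hL.eq_nil_of_head (p := X Q₀ ++ (s ++ w :: t) ++ s') (q := t') (by simp [e'])
        simp at this
      have hAb : ∀ c ∈ A, c ∉ b :: q := by
        intro c hc hcb
        have := h.disjoint_extra Q₀ hQ₀ c hc (by rw [hY]; simp at hcb ⊢; tauto)
        exact hrb (this ▸ hcb)
      have hext : ∀ c ∈ X Q₀ ++ s ++ [w], c ∈ reachStage G r y Qs (n + 1) := by
        intro c hc
        simp only [List.append_assoc, List.mem_append, List.mem_singleton] at hc
        rcases hc with hc | hc | rfl
        · exact hsub (h.new_subset Q₀ hQ₀ c hc)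
        · exact hpN c (by simp [hc])
        · exact hw'
      have hextL : ∀ c ∈ X Q₀ ++ s ++ [w], c ∈ X Q₀ ++ Y Q₀ := by
        intro c hc
        rw [hY]
        simp at hc ⊢
        tauto
      have htailL : ∀ c ∈ b :: q, c ∈ X Q₀ ++ Y Q₀ := by
        intro c hc
        rw [hY]
        simp at hc ⊢
        tauto
      have hdisj' : ∀ Q ∈ Qs, Q ≠ Q₀ → ∀ c ∈ A ++ b :: q, c ∈ X Q ++ Y Q → c = r ∨ c = y := by
        intro Q hQ hne c hc hcQ
        rcases List.mem_append.1 hc with hc | hc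
        · exact .inl (h.disjoint_extra Q hQ c hc hcQ)
        · exact h.disjoint Q hQ Q₀ hQ₀ hne c hcQ (htailL c hc)
      refine ⟨Function.update X Q₀ A, Function.update Y Q₀ (b :: q),
        Function.update Z Q₀ (Z Q₀ ++ (s ++ w :: t)), X Q₀ ++ s ++ [w], hnew, hext, ?_, ?_, ?_, ?_,
        ?_, ?_, ?_⟩
      · intro Q hQ
        by_cases hne : Q = Q₀
        · subst hne
          simpa using h.isPathList_extra.append htail hab hAb
        · simpa [hne] using h.isPathList Q hQ
      · intro Q hQ
        by_cases hne : Q = Q₀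
        · subst hne
          simpa using e
        · simpa [hne] using h.verts_eq Q hQ
      · intro Q hQ
        by_cases hne : Q = Q₀
        · subst hne
          have : q ≠ [] := by
            rintro rfl
            exact hby (by simpa using htail.last)
          have := List.length_pos_of_ne_nil this
          simp only [Function.update_self, List.length_cons]
          omega
        · simpa [hne] using h.two_le_length Q hQ
      · intro Q hQ
        by_cases hne : Q = Q₀
        · subst hne
          simpa using fun c hc => hsub (h.extra_subset c hc)
        · simpa [hne] using fun c hc => hsub (h.new_subset Q hQ c hc)
      · intro Q hQ
        by_cases hne : Q = Q₀
        · subst hne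
          simpa only [Function.update_self] using hpN
        · simpa [hne] using fun c hc => hsub (h.old_subset Q hQ c hc)
      · intro Q hQ c hc hcQ
        by_cases hne : Q = Q₀
        · subst hne
          simp only [Function.update_self] at hcQ
          rcases List.mem_append.1 hcQ with hcQ | hcQ
          · exact h.disjoint_extra Q hQ c hcQ (hextL c hc)
          · have hn := hL.nodup
            have : X Q ++ (s ++ w :: t ++ b :: q) = (X Q ++ s ++ [w]) ++ (t ++ b :: q) := by simp
            rw [this, List.nodup_append] at hn
            exact absurd rfl (hn.2.2 c hc c (List.mem_append_right _ hcQ))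
        · simp only [ne_eq, hne, not_false_eq_true, Function.update_of_ne] at hcQ
          rcases h.disjoint Q hQ Q₀ hQ₀ hne c hcQ (hextL c hc) with rfl | rfl
          · rfl
          · exact absurd (hext c hc) (hyN _)
      · intro Q hQ Q' hQ' hQQ' c hc hc'
        by_cases hne : Q = Q₀
        · subst hne
          simp only [Function.update_self, ne_eq, Ne.symm hQQ', not_false_eq_true,
            Function.update_of_ne] at hc hc'
          exact hdisj' Q' hQ' (Ne.symm hQQ') c hc hc'
        · by_cases hne' : Q' = Q₀
          · subst hne'
            simp only [Function.update_self, ne_eq, hQQ', not_false_eq_true,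
              Function.update_of_ne] at hc hc'
            exact hdisj' Q hQ hQQ' c hc' hc
          · simp only [ne_eq, hne, hne', not_false_eq_true, Function.update_of_ne] at hc hc'
            exact h.disjoint Q hQ Q' hQ' hQQ' c hc hc'

theorem IsRerouting.union_mem_GSet {N : Set V} {x : V} {X Y Z : DiPath V → List V} {A : List V}
    (h : IsRerouting G r y Qs N x X Y Z A) (hQs : IntDisjSystem G r y Qs) (hy : y ∉ N) :
    lastEdges Qs ∪ {(x, y)} ∈ GSet (G ∪ {(x, y)}) r y := by
  have hmono : ∀ c d, Adj G c d → Adj (G ∪ {(x, y)}) c d := fun c d hcd => .inl hcd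
  have hA : IsPathList (Adj (G ∪ {(x, y)})) r y (A ++ [y]) :=
    (h.isPathList_extra.mono hmono).snoc (.inr rfl) fun hyA => hy (h.extra_subset y hyA)
  let L : Qs → DiPath V := fun Q => (h.isPathList Q Q.2).toDiPath
  have hL : ∀ Q : Qs, IsPath (G ∪ {(x, y)}) r y (L Q) :=
    fun Q => isPath_iff.2 ((h.isPathList Q Q.2).mono hmono)
  have hA' : IsPath (G ∪ {(x, y)}) r y hA.toDiPath := isPath_iff.2 hA
  have hdisjA : ∀ Q : Qs, (L Q).vertexSet ∩ hA.toDiPath.vertexSet ⊆ {r, y} := by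
    rintro Q c ⟨hc, hcA⟩
    rcases List.mem_append.1 (show c ∈ A ++ [y] from hcA) with hcA | hcA
    · exact .inl (h.disjoint_extra Q Q.2 c hcA hc)
    · exact .inr (by simpa using hcA)
  have hsup : ∀ {P : DiPath V}, IsPath (G ∪ {(x, y)}) r y P → {r, y} ⊆ P.vertexSet := by
    rintro P hP c (rfl | rfl)
    · exact (isPath_iff.1 hP).head_mem
    · exact (isPath_iff.1 hP).last_mem
  refine ⟨insert hA.toDiPath (Set.range L), ⟨?_, ?_⟩, ?_⟩
  · rintro P (rfl | ⟨Q, rfl⟩)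
    · exact hA'
    · exact hL Q
  · rintro P (rfl | ⟨Q, rfl⟩) P' (rfl | ⟨Q', rfl⟩) hne
    · exact absurd rfl hne
    · refine subset_antisymm ?_ (Set.subset_inter (hsup hA') (hsup (hL Q')))
      rw [Set.inter_comm]
      exact hdisjA Q'
    · exact subset_antisymm (hdisjA Q) (Set.subset_inter (hsup (hL Q)) (hsup hA'))
    · refine subset_antisymm ?_ (Set.subset_inter (hsup (hL Q)) (hsup (hL Q')))
      rintro c ⟨hc, hc'⟩
      refine h.disjoint Q Q.2 Q' Q'.2 ?_ c hc hc'
      intro e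
      exact hne (by rw [Subtype.ext e])
  · have hlast : ∀ Q : Qs, (L Q).lastEdge = Q.1.lastEdge := fun Q =>
      lastEdge_eq (hL Q) (hQs.1 Q Q.2) (X := X Q) (Z := Z Q) (Y := Y Q) rfl (h.verts_eq Q Q.2)
        (h.two_le_length Q Q.2)
    have hlastA : hA.toDiPath.lastEdge = {(x, y)} := by
      ext ⟨c, d⟩
      rw [mem_lastEdge_iff hA']
      obtain ⟨A', rfl⟩ : ∃ A', A = A' ++ [x] :=
        List.getLast?_eq_some_iff.1 h.isPathList_extra.last
      simp only [Set.mem_singleton_iff, Prod.mk.injEq]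
      constructor
      · rintro ⟨rfl, p, e⟩
        have := congrArg List.reverse (show (A' ++ [x]) ++ [d] = p ++ [c, d] from e)
        simp at this
        exact ⟨this.1.symm, rfl⟩
      · rintro ⟨rfl, rfl⟩
        exact ⟨rfl, A', List.append_assoc ..⟩
    simp only [lastEdges, Set.biUnion_insert, hlastA, Set.biUnion_range, hlast]
    rw [Set.union_comm, Set.biUnion_eq_iUnion]

/-- If the set of last edges of `Qs` cannot be extended by `xy`, then there is a set containing `x`
whose entrances lie on `Qs`. -/
theorem exists_separated_set (hQs : IntDisjSystem G r y Qs) {x : V}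
    (hy : y ≠ r) (hxy : x ≠ y) (h : lastEdges Qs ∪ {(x, y)} ∉ GSet (G ∪ {(x, y)}) r y) :
    ∃ C : Set V, x ∈ C ∧ r ∉ C ∧ y ∉ C ∧
      (∀ a b, (a, b) ∈ G → a ∉ C → a ≠ y → b ∈ C →
        ∃ Q ∈ Qs, ∃ p q, Q.verts = p ++ b :: q ∧ ∀ w ∈ p, w ∉ C) ∧
      ∀ Q ∈ Qs, ∀ p z q, Q.verts = p ++ z :: q → z ∉ C → z ≠ y → ∀ w ∈ p, w ∉ C := by
  refine ⟨{z | z ≠ y ∧ ∀ n, z ∉ reachStage G r y Qs n}, ⟨hxy, ?_⟩, ?_, ?_, ?_, ?_⟩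
  · intro n hn
    obtain ⟨X, Y, Z, A, hR⟩ := exists_isRerouting hQs hy n x hn
    exact h (hR.union_mem_GSet hQs (not_mem_reachStage hQs hy n))
  · rintro ⟨-, hr⟩
    exact hr 0 rfl
  · rintro ⟨hyy, -⟩
    exact hyy rfl
  · rintro a b hab ha hay ⟨hby, hb⟩
    obtain ⟨n, hn⟩ : ∃ n, a ∈ reachStage G r y Qs n := by
      by_contra hcon
      push Not at hcon
      exact ha ⟨hay, hcon⟩
    by_cases hbQ : ∀ Q ∈ Qs, b ∉ Q.verts
    · exact absurd (.inl (.inr ⟨hby, hbQ, a, hn, hab⟩)) (hb (n + 1))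
    · push Not at hbQ
      obtain ⟨Q, hQ, hbQ⟩ := hbQ
      obtain ⟨p, q, e⟩ := List.mem_iff_append.1 hbQ
      refine ⟨Q, hQ, p, q, e, ?_⟩
      rintro w hw ⟨-, hwn⟩
      exact hwn (n + 1) (.inr ⟨a, hn, Q, hQ, p, b, q, e, hw, hby, hab⟩)
  · rintro Q hQ p z q e hz hzy w hw ⟨-, hwn⟩
    obtain ⟨n, hn⟩ : ∃ n, z ∈ reachStage G r y Qs n := by
      by_contra hcon
      push Not at hcon
      exact hz ⟨hzy, hcon⟩
    have hpath := isPath_iff.1 (hQs.1 Q hQ)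
    induction n with
    | zero =>
      obtain rfl : z = r := hn
      obtain rfl := hpath.eq_nil_of_head e
      simp at hw
    | succ n ih =>
      rcases hn with (hn | ⟨-, hn, -⟩) | ⟨a, ha, Q', hQ', p', b, q', e', hz', hby, hab⟩
      · exact ih hn
      · exact hn Q hQ (by simp [e])
      · have hzr : z ≠ r := by
          rintro rfl
          obtain rfl := hpath.eq_nil_of_head e
          simp at hw
        obtain rfl : Q = Q' := by
          by_contra hne
          have : z ∈ Q.vertexSet ∩ Q'.vertexSet :=
            ⟨show z ∈ Q.verts by simp [e], show z ∈ Q'.verts by simp [e', hz']⟩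
          rw [hQs.2 Q hQ Q' hQ' hne] at this
          rcases this with h1 | h1
          · exact hzr h1
          · exact hzy h1
        obtain ⟨s, t, rfl⟩ := List.mem_iff_append.1 hz'
        have hn := hpath.nodup
        rw [e] at hn
        obtain ⟨rfl, -⟩ := eq_of_append_cons_eq_of_nodup (p' := s) (q' := t ++ b :: q')
          (by rw [← e, e']; simp) hn
        exact hwn (n + 1) (.inr ⟨a, ha, Q, hQ, _, b, q', e', by simp [hw], hby, hab⟩)

end Augmentation

section Tight

theorem IntDisjSystem.eq_of_mem {D : Set (V × V)} {r v : V} {Ps : Set (DiPath V)}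
    (h : IntDisjSystem D r v Ps) {P P' : DiPath V} (hP : P ∈ Ps) (hP' : P' ∈ Ps) {c : V}
    (hc : c ∈ P.verts) (hc' : c ∈ P'.verts) (hr : c ≠ r) (hv : c ≠ v) : P = P' := by
  by_contra hne
  have : c ∈ P.vertexSet ∩ P'.vertexSet := ⟨hc, hc'⟩
  rw [h.2 P hP P' hP' hne] at this
  rcases this with h1 | h1
  · exact hr h1
  · exact hv h1

theorem IntDisjSystem.mono {D D' : Set (V × V)} {r v : V} {Ps : Set (DiPath V)}
    (h : IntDisjSystem D r v Ps) (hD : D ⊆ D') : IntDisjSystem D' r v Ps :=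
  ⟨fun P hP => ⟨(h.1 P hP).1.trans hD, (h.1 P hP).2⟩, h.2⟩

/-- `B` contains `v` but not `r`, no edge of `D` other than `rv` enters `B` at `v`, and the head of
every edge of `D` entering `B` is the first vertex in `B` of some member of `Ps`. -/
structure IsTight (D : Set (V × V)) (r v : V) (Ps : Set (DiPath V)) (B : Set V) : Prop where
  root_not_mem : r ∉ B
  target_mem : v ∈ B
  entry : ∀ a b, (a, b) ∈ D → a ∉ B → b ∈ B → (b = v → a = r) ∧
    ∃ P ∈ Ps, ∃ p q, P.verts = p ++ b :: q ∧ ∀ w ∈ p, w ∉ B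

variable {D G : Set (V × V)} {r v : V} {Ps : Set (DiPath V)} {B : Set V}

theorem IsTight.eq_singleton (hB : IsTight G r v Ps B) (hPs : IntDisjSystem G r v Ps)
    {P : DiPath V} (hP : P ∈ Ps) {p q : List V} (e : P.verts = p ++ v :: q)
    (hp : ∀ w ∈ p, w ∉ B) : p = [r] := by
  have h := isPath_iff.1 (hPs.1 P hP)
  rcases List.eq_nil_or_concat p with rfl | ⟨p, c, rfl⟩
  · have h1 := h.head
    rw [e] at h1
    have : v = r := by simpa using h1
    exact absurd (this ▸ hB.target_mem) hB.root_not_mem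
  · rw [List.concat_eq_append] at *
    have hcv : (c, v) ∈ G := h.rel_of_eq (p := p) (q := q) (by simp [e])
    obtain rfl : c = r := (hB.entry c v hcv (hp c (by simp)) hB.target_mem).1 rfl
    obtain rfl := h.eq_nil_of_head (p := p) (q := v :: q) (by simp [e])
    rfl

theorem IsTight.mem_of_mem_after (hB : IsTight G r v Ps B) (hPs : IntDisjSystem G r v Ps)
    {P : DiPath V} (hP : P ∈ Ps) {p q : List V} {z : V} (e : P.verts = p ++ z :: q)
    (hz : z ∈ B) : ∀ w ∈ q, w ∈ B := by
  by_contra hcon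
  push Not at hcon
  obtain ⟨w, hw, hwB⟩ := hcon
  have h := isPath_iff.1 (hPs.1 P hP)
  have hzq := h.drop e
  obtain ⟨k, c, d, k', e', hc, hd⟩ := exists_last_entry hzq.last hB.target_mem
    ⟨w, List.mem_cons_of_mem _ hw, hwB⟩
  have e'' : P.verts = p ++ k ++ c :: d :: k' := by simp [e, e']
  have hcd : (c, d) ∈ G := h.rel_of_eq e''
  obtain ⟨h1, P', hP', p', q', e₁, hp'⟩ := hB.entry c d hcd hc (hd d (by simp))
  have hk : k ≠ [] := by
    rintro rfl
    simp at e'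
    exact hc (e'.1 ▸ hz)
  obtain ⟨k, rfl⟩ : ∃ k₁, k = z :: k₁ := by
    cases k with
    | nil => exact absurd rfl hk
    | cons x k =>
      simp at e'
      exact ⟨k, by rw [e'.1]⟩
  have hdv : d ≠ v := by
    intro hdv
    obtain rfl := h1 hdv
    have := h.eq_nil_of_head e''
    simp at this
  have hdr : d ≠ r := by
    rintro rfl
    exact hB.root_not_mem (hd d (by simp))
  obtain rfl := hPs.eq_of_mem hP hP' (c := d) (by simp [e'']) (by simp [e₁]) hdr hdv
  have hn := h.nodup
  rw [e₁] at hn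
  obtain ⟨rfl, -⟩ := eq_of_append_cons_eq_of_nodup (p' := p ++ z :: k ++ [c]) (q' := k')
    (by rw [← e₁, e'']; simp) hn
  exact hp' z (by simp) hz

theorem isTight_sUnion (hPs : IntDisjSystem G r v Ps) {F : Set (Set V)} (hne : F.Nonempty)
    (hF : ∀ B ∈ F, IsTight G r v Ps B) : IsTight G r v Ps (⋃₀ F) := by
  obtain ⟨B₀, hB₀⟩ := hne
  refine ⟨?_, ⟨B₀, hB₀, (hF B₀ hB₀).target_mem⟩, ?_⟩
  · rintro ⟨B, hB, hr⟩
    exact (hF B hB).root_not_mem hr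
  · rintro a b hab ha ⟨B, hB, hb⟩
    have haF : ∀ B ∈ F, a ∉ B := fun B hB haB => ha ⟨B, hB, haB⟩
    obtain ⟨h1, P, hP, p, q, e, hp⟩ := (hF B hB).entry a b hab (haF B hB) hb
    refine ⟨h1, P, hP, p, q, e, ?_⟩
    rintro z hz ⟨B', hB', hzB'⟩
    by_cases hbv : b = v
    · subst hbv
      obtain rfl := (hF B hB).eq_singleton hPs hP e hp
      obtain rfl : z = r := by simpa using hz
      exact (hF B' hB').root_not_mem hzB'
    · obtain ⟨s, t, rfl⟩ := List.mem_iff_append.1 hz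
      have hbB' : b ∈ B' := (hF B' hB').mem_of_mem_after hPs hP (p := s) (q := t ++ b :: q)
        (by simp [e]) hzB' b (by simp)
      obtain ⟨-, P', hP', p', q', e', hp'⟩ := (hF B' hB').entry a b hab (haF B' hB') hbB'
      have hbr : b ≠ r := by
        rintro rfl
        exact (hF B hB).root_not_mem hb
      obtain rfl := hPs.eq_of_mem hP hP' (c := b) (by simp [e]) (by simp [e']) hbr hbv
      have hn := P.nodup
      rw [e] at hn
      obtain ⟨rfl, -⟩ := eq_of_append_cons_eq_of_nodup (e.symm.trans e') hn
      exact hp' z hz hzB'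

open Classical in
theorem IsTight.eMSystem (hPs : IntDisjSystem D r v Ps) (hB : IsTight D r v Ps B) :
    EMSystem D r v Ps := by
  let First (P : DiPath V) (s : V) : Prop :=
    s ∈ P.internal ∧ s ∈ B ∧ ∃ p q, P.verts = p ++ s :: q ∧ ∀ w ∈ p, w ∉ B
  have hint : ∀ P ∈ Ps, ∀ s, s ∈ P.internal ↔ s ∈ P.verts ∧ s ≠ r ∧ s ≠ v := by
    intro P hP s
    simp [DiPath.internal, DiPath.vertexSet, (hPs.1 P hP).2.1, (hPs.1 P hP).2.2]
  have hentry : ∀ Q, IsPath D r v Q → ∃ k c d k', Q.verts = k ++ c :: d :: k' ∧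
      (∀ w ∈ k ++ [c], w ∉ B) ∧ d ∈ B := by
    intro Q hQ
    have h := isPath_iff.1 hQ
    exact exists_first_entry h.head hB.root_not_mem ⟨v, h.last_mem, hB.target_mem⟩
  have hBr : ∀ {d}, d ∈ B → d ≠ r := by
    rintro d hd rfl
    exact hB.root_not_mem hd
  refine ⟨hPs, fun P => if h : ∃ s, First P s then .inl h.choose else .inr (r, v), ?_, ?_⟩
  · intro P hP
    by_cases h : ∃ s, First P s
    · simp only [h, ↓reduceDIte, Sum.inl.injEq, reduceCtorEq, false_implies, implies_true, and_true]
      rintro x rfl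
      exact h.choose_spec.1
    · simp only [h, ↓reduceDIte, reduceCtorEq, false_implies, implies_true, Sum.inr.injEq, true_and]
      rintro _ rfl
      obtain ⟨k, c, d, k', e, hc, hd⟩ := hentry P (hPs.1 P hP)
      have hcd : (c, d) ∈ D := (isPath_iff.1 (hPs.1 P hP)).rel_of_eq e
      by_cases hdv : d = v
      · subst hdv
        obtain rfl := (hB.entry c d hcd (hc c (by simp)) hd).1 rfl
        exact mem_edges_iff.2 ⟨k, k', e⟩
      · exact absurd ⟨d, (hint P hP d).2 ⟨by simp [e], hBr hd, hdv⟩, hd, k ++ [c], k', by simp [e],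
          hc⟩ h
  · intro Q hQ
    obtain ⟨k, c, d, k', e, hc, hd⟩ := hentry Q hQ
    have hcd : (c, d) ∈ D := (isPath_iff.1 hQ).rel_of_eq e
    obtain ⟨h1, P, hP, p, q, eP, hp⟩ := hB.entry c d hcd (hc c (by simp)) hd
    refine ⟨P, hP, ?_⟩
    by_cases h : ∃ s, First P s
    · simp only [h, ↓reduceDIte, Sum.inl.injEq, reduceCtorEq, false_implies, implies_true, and_true]
      rintro x rfl
      obtain ⟨-, h2, p', q', e', hp'⟩ := h.choose_spec
      obtain ⟨-, h3, -⟩ := eq_of_append_cons_eq (eP.symm.trans e') hp hp' hd h2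
      rw [← h3]
      show d ∈ Q.verts
      simp [e]
    · simp only [h, ↓reduceDIte, reduceCtorEq, false_implies, implies_true, Sum.inr.injEq, true_and]
      rintro _ rfl
      by_cases hdv : d = v
      · subst hdv
        obtain rfl := h1 rfl
        exact mem_edges_iff.2 ⟨k, k', e⟩
      · exact absurd ⟨d, (hint P hP d).2 ⟨by simp [eP], hBr hd, hdv⟩, hd, p, q, eP, hp⟩ h

theorem EMSystem.exists_isTight (hv : v ≠ r) (h : EMSystem G r v Ps) :
    ∃ B, IsTight G r v Ps B := by
  obtain ⟨hPs, sel, hsel, hcov⟩ := h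
  have hint : ∀ P ∈ Ps, ∀ s, s ∈ P.internal ↔ s ∈ P.verts ∧ s ≠ r ∧ s ≠ v := by
    intro P hP s
    simp [DiPath.internal, DiPath.vertexSet, (hPs.1 P hP).2.1, (hPs.1 P hP).2.2]
  let Sel (P : DiPath V) (s : V) : Prop := s ≠ r ∧ s ≠ v ∧
    (sel P = .inl s ∨ (∃ c, sel P = .inr (c, s)) ∨ sel P = .inr (s, v))
  have hSel_mem : ∀ P ∈ Ps, ∀ s, Sel P s → s ∈ P.verts := by
    rintro P hP s ⟨-, -, h | ⟨c, h⟩ | h⟩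
    · exact ((hint P hP s).1 ((hsel P hP).1 s h)).1
    · obtain ⟨p, q, e⟩ := mem_edges_iff.1 ((hsel P hP).2 _ h)
      simp [e]
    · obtain ⟨p, q, e⟩ := mem_edges_iff.1 ((hsel P hP).2 _ h)
      simp [e]
  have hSel_unique : ∀ P s s', Sel P s → Sel P s' → s = s' := by
    rintro P s s' ⟨-, h1, h2⟩ ⟨-, h1', h2'⟩
    rcases h2 with h | ⟨c, h⟩ | h <;> rcases h2' with h' | ⟨c', h'⟩ | h' <;>
      rw [h] at h' <;> simp at h' <;> grind
  let S : Set V := {s | ∃ P ∈ Ps, Sel P s}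
  have hS_unique : ∀ P ∈ Ps, ∀ s ∈ P.verts, ∀ s' ∈ P.verts, s ∈ S → s' ∈ S → s = s' := by
    rintro P hP s hs s' hs' ⟨P₁, hP₁, h₁⟩ ⟨P₂, hP₂, h₂⟩
    obtain rfl := hPs.eq_of_mem hP hP₁ hs (hSel_mem _ hP₁ _ h₁) h₁.1 h₁.2.1
    obtain rfl := hPs.eq_of_mem hP hP₂ hs' (hSel_mem _ hP₂ _ h₂) h₂.1 h₂.2.1
    exact hSel_unique _ _ _ h₁ h₂
  let R (a b : V) : Prop := (a, b) ∈ G ∧ (a, b) ≠ (r, v) ∧ b ∉ S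
  refine ⟨{w | ¬ Relation.ReflTransGen R r w}, fun h => h .refl, ?_, ?_⟩
  · intro hreach
    obtain ⟨l, hl⟩ := exists_isPathList hreach
    have hlS : ∀ s ∈ l, s ≠ r → s ∉ S := by
      intro s hs hsr
      obtain ⟨p, q, e⟩ := List.mem_iff_append.1 hs
      rcases List.eq_nil_or_concat p with rfl | ⟨p, c, rfl⟩
      · have := hl.head
        rw [e] at this
        exact absurd (by simpa using this) hsr
      · exact (hl.rel_of_eq (p := p) (q := q) (c := c) (by simp [e])).2.2
    obtain ⟨P, hP, h1, h2⟩ := hcov hl.toDiPath (isPath_iff.2 (hl.mono fun _ _ h => h.1))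
    rcases hs : sel P with s | ⟨c, d⟩
    · obtain ⟨-, hsr, hsv⟩ := (hint P hP s).1 ((hsel P hP).1 s hs)
      exact hlS s (h1 s hs) hsr ⟨P, hP, hsr, hsv, .inl hs⟩
    · obtain ⟨p, q, e⟩ := mem_edges_iff.1 (h2 _ hs)
      change l = _ at e
      have hcd := hl.rel_of_eq e
      have hdr : d ≠ r := by
        rintro rfl
        have := hl.eq_nil_of_head (p := p ++ [c]) (q := q) (by simp [e])
        simp at this
      by_cases hdv : d = v
      · subst hdv
        have hcr : c ≠ r := by
          rintro rfl
          exact hcd.2.1 rfl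
        have hcd' : c ≠ d := by
          rintro rfl
          have := hl.eq_nil_of_last e
          simp at this
        exact hlS c (by simp [e]) hcr ⟨P, hP, hcr, hcd', .inr (.inr hs)⟩
      · exact hcd.2.2 ⟨P, hP, hdr, hdv, .inr (.inl ⟨c, hs⟩)⟩
  · intro a b hab ha hb
    have ha : Relation.ReflTransGen R r a := not_not.1 ha
    have hbr : b ≠ r := by
      rintro rfl
      exact hb .refl
    by_cases habv : (a, b) = (r, v)
    · obtain ⟨rfl, rfl⟩ := Prod.mk.inj habv
      refine ⟨fun _ => rfl, ?_⟩
      have hrv : IsPathList (Adj G) a b [a, b] :=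
        ⟨by simpa [Adj] using hab, by simpa using hv.symm, by simp, by simp⟩
      obtain ⟨P, hP, h1, h2⟩ := hcov hrv.toDiPath (isPath_iff.2 hrv)
      rcases hs : sel P with s | ⟨c, d⟩
      · obtain ⟨-, hsr, hsv⟩ := (hint P hP s).1 ((hsel P hP).1 s hs)
        have : s ∈ [a, b] := h1 s hs
        simp [hsr, hsv] at this
      · have hcd : (c, d) = (a, b) := by simpa [IsPathList.toDiPath, DiPath.edges] using h2 _ hs
        obtain ⟨rfl, rfl⟩ := Prod.mk.inj hcd
        obtain ⟨p, q, e⟩ := mem_edges_iff.1 ((hsel P hP).2 _ hs)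
        obtain rfl := (isPath_iff.1 (hPs.1 P hP)).eq_nil_of_head e
        refine ⟨P, hP, [c], q, by simpa using e, ?_⟩
        simpa using Relation.ReflTransGen.refl
    · have hbS : b ∈ S := by
        by_contra hbS
        exact hb (ha.tail ⟨hab, habv, hbS⟩)
      obtain ⟨P, hP, hbP⟩ := hbS
      refine ⟨fun h => absurd h hbP.2.1, P, hP, ?_⟩
      have h := isPath_iff.1 (hPs.1 P hP)
      obtain ⟨p, q, e⟩ := List.mem_iff_append.1 (hSel_mem P hP b hbP)
      refine ⟨p, q, e, fun w hw => not_not.2 ?_⟩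
      have hn := h.nodup
      rw [e, List.nodup_append] at hn
      have hpne : p ≠ [] := List.ne_nil_of_mem hw
      have hpath : IsPathList R r (p.getLast hpne) p := by
        refine ⟨?_, hn.1, ?_, List.getLast?_eq_some_getLast _⟩
        · rw [List.isChain_iff_forall_rel_of_append_cons_cons]
          rintro c d s t rfl
          refine ⟨h.rel_of_eq (p := s) (q := t ++ b :: q) (by simp [e]), ?_, ?_⟩
          · intro hcd
            obtain ⟨rfl, rfl⟩ := Prod.mk.inj hcd
            have := h.eq_nil_of_last (p := s ++ [c]) (q := t ++ b :: q) (by simp [e])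
            simp at this
          · intro hd
            have hdb := hS_unique P hP d (by simp [e]) b (by simp [e]) hd ⟨P, hP, hbP⟩
            exact hn.2.2 d (by simp) b (by simp) hdb
        · have := h.head
          rwa [e, List.head?_append_of_ne_nil _ hpne] at this
      exact hpath.reflTransGen hw

end Tight

section Uncrossing

variable {D G : Set (V × V)} {r v y : V} {Ps Qs : Set (DiPath V)} {B : Set V}

/-- The `r→y` paths of `Qs` can be rerouted to enter the tight set `B` only once, along initial
segments of the members of `Ps`, without changing the last edges. -/
theorem IsTight.exists_uncrossed (hB : IsTight G r v Ps B) (hPs : IntDisjSystem G r v Ps)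
    (hQs : IntDisjSystem G r y Qs) (hy : y ∈ B)
    (hlast : ∀ a, (a, y) ∈ G → a ∉ B → y = v ∧ a = r) :
    ∃ Qs', IntDisjSystem G r y Qs' ∧ lastEdges Qs' = lastEdges Qs ∧
      ∀ Q ∈ Qs', ∃ P ∈ Ps, ∃ W e W' Y, P.verts = W ++ e :: W' ∧ Q.verts = W ++ e :: Y ∧
        (∀ w ∈ W, w ∉ B) ∧ ∀ w ∈ e :: Y, w ∈ B := by
  have : Nonempty V := ⟨r⟩
  have key : ∀ Q ∈ Qs, ∃ Q', IsPath G r y Q' ∧ Q'.lastEdge = Q.lastEdge ∧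
      ∃ P ∈ Ps, ∃ W e W' Y Z, P.verts = W ++ e :: W' ∧ Q'.verts = W ++ e :: Y ∧
        Q.verts = Z ++ e :: Y ∧ (∀ w ∈ W, w ∉ B) ∧ (∀ w ∈ e :: Y, w ∈ B) ∧
        (e = y → W = [r]) := by
    intro Q hQ
    have hQl := isPath_iff.1 (hQs.1 Q hQ)
    obtain ⟨Z, a, e, Y, eQ, ha, hY⟩ := exists_last_entry hQl.last hy
      ⟨r, hQl.head_mem, hB.root_not_mem⟩
    have hae : (a, e) ∈ G := hQl.rel_of_eq eQ
    have he : e ∈ B := hY e (by simp)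
    obtain ⟨-, P, hP, W, W', eP, hW⟩ := hB.entry a e hae ha he
    have hPl := isPath_iff.1 (hPs.1 P hP)
    have eQ' : Q.verts = (Z ++ [a]) ++ e :: Y := by simp [eQ]
    have hdrop := hQl.drop eQ'
    have hpath : IsPathList (Adj G) r y (W ++ e :: Y) := by
      rcases List.eq_nil_or_concat W with rfl | ⟨W, c, rfl⟩
      · have := hPl.head
        rw [eP] at this
        obtain rfl : e = r := by simpa using this
        exact absurd he hB.root_not_mem
      · rw [List.concat_eq_append] at *
        have hc : Adj G c e := hPl.rel_of_eq (p := W) (q := W') (by simp [eP])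
        exact (hPl.take (p := W) (q := e :: W') (by simp [eP])).append hdrop hc
          fun w hw hw' => hW w hw (hY w hw')
    have hWr : e = y → W = [r] := by
      rintro rfl
      obtain ⟨rfl, -⟩ := hlast a hae ha
      exact hB.eq_singleton hPs hP eP hW
    refine ⟨hpath.toDiPath, isPath_iff.2 hpath, ?_, P, hP, W, e, W', Y, Z ++ [a], eP, rfl, eQ', hW,
      hY, hWr⟩
    by_cases hey : e = y
    · have hW1 := hWr hey
      subst hey hW1
      obtain ⟨-, rfl⟩ := hlast a hae ha
      obtain rfl := hQl.eq_nil_of_head eQ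
      exact congrArg DiPath.lastEdge (DiPath.ext eQ.symm)
    · refine lastEdge_eq (isPath_iff.2 hpath) (hQs.1 Q hQ) (X := W) (Y := e :: Y) rfl eQ' ?_
      cases Y with
      | nil => exact absurd (by simpa using hdrop.last) hey
      | cons _ _ => simp
  choose! f hf hfl g hg W e W' Y Z eg ef eQ hW hY hWr using key
  refine ⟨f '' Qs, ⟨?_, ?_⟩, ?_, ?_⟩
  · rintro _ ⟨Q, hQ, rfl⟩
    exact hf Q hQ
  · rintro _ ⟨Q₁, hQ₁, rfl⟩ _ ⟨Q₂, hQ₂, rfl⟩ hne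
    have hne' : Q₁ ≠ Q₂ := fun h => hne (h ▸ rfl)
    have hYY : ∀ w ∈ e Q₁ :: Y Q₁, w ∈ e Q₂ :: Y Q₂ → w = y := by
      intro w hw hw'
      by_contra hwy
      refine hne' (hQs.eq_of_mem hQ₁ hQ₂ (c := w) ?_ ?_ ?_ hwy)
      · rw [eQ Q₁ hQ₁]
        exact List.mem_append_right _ hw
      · rw [eQ Q₂ hQ₂]
        exact List.mem_append_right _ hw'
      · rintro rfl
        exact hB.root_not_mem (hY Q₁ hQ₁ w hw)
    apply Set.Subset.antisymm
    · rintro w ⟨hw₁, hw₂⟩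
      change w ∈ (f Q₁).verts at hw₁
      change w ∈ (f Q₂).verts at hw₂
      rw [ef Q₁ hQ₁, List.mem_append] at hw₁
      rw [ef Q₂ hQ₂, List.mem_append] at hw₂
      rcases hw₁ with hw₁ | hw₁ <;> rcases hw₂ with hw₂ | hw₂
      · left
        by_contra hwr
        have hwr : w ≠ r := hwr
        have hwB := hW Q₁ hQ₁ w hw₁
        have hgg : g Q₁ = g Q₂ := by
          refine hPs.eq_of_mem (hg Q₁ hQ₁) (hg Q₂ hQ₂) (c := w) ?_ ?_ hwr ?_
          · rw [eg Q₁ hQ₁]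
            exact List.mem_append_left _ hw₁
          · rw [eg Q₂ hQ₂]
            exact List.mem_append_left _ hw₂
          · rintro rfl
            exact hwB hB.target_mem
        have h1 := eg Q₁ hQ₁
        rw [hgg, eg Q₂ hQ₂] at h1
        obtain ⟨-, hee, -⟩ := eq_of_append_cons_eq h1 (hW Q₂ hQ₂) (hW Q₁ hQ₁)
          (hY Q₂ hQ₂ _ (by simp)) (hY Q₁ hQ₁ _ (by simp))
        have hey : e Q₁ = y := hYY _ (by simp) (by simp [hee])
        rw [hWr Q₁ hQ₁ hey] at hw₁
        exact hwr (by simpa using hw₁)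
      · exact absurd (hY Q₂ hQ₂ w hw₂) (hW Q₁ hQ₁ w hw₁)
      · exact absurd (hY Q₁ hQ₁ w hw₁) (hW Q₂ hQ₂ w hw₂)
      · exact .inr (hYY w hw₁ hw₂)
    · have h₁ := isPath_iff.1 (hf Q₁ hQ₁)
      have h₂ := isPath_iff.1 (hf Q₂ hQ₂)
      rintro w (rfl | rfl)
      · exact ⟨h₁.head_mem, h₂.head_mem⟩
      · exact ⟨h₁.last_mem, h₂.last_mem⟩
  · simp only [lastEdges, Set.biUnion_image]
    exact Set.iUnion₂_congr hfl
  · rintro _ ⟨Q, hQ, rfl⟩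
    exact ⟨g Q, hg Q hQ, W Q, e Q, W' Q, Y Q, eg Q hQ, ef Q hQ, hW Q hQ, hY Q hQ⟩

/-- If some member of `𝒢_G(y)` cannot be extended by `xy`, then adding `xy` to the digraph keeps the
largest tight set tight. -/
theorem IsTight.entry_of_not_mem_GSet (hPs : IntDisjSystem G r v Ps)
    (hB : IsTight G r v Ps B) (hmax : ∀ B', IsTight G r v Ps B' → B' ⊆ B) {x : V}
    (hx : x ∉ B) (hy : y ∈ B) (hQs : IntDisjSystem G r y Qs)
    (h : lastEdges Qs ∪ {(x, y)} ∉ GSet (G ∪ {(x, y)}) r y) :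
    (y = v → x = r) ∧ ∃ P ∈ Ps, ∃ p q, P.verts = p ++ y :: q ∧ ∀ w ∈ p, w ∉ B := by
  by_contra hcon
  have hBr : ∀ {b}, b ∈ B → b ≠ r := by
    rintro b hb rfl
    exact hB.root_not_mem hb
  have hlast : ∀ a, (a, y) ∈ G → a ∉ B → y = v ∧ a = r := by
    intro a hay ha
    obtain ⟨h1, h2⟩ := hB.entry a y hay ha hy
    have hyv : y = v := by
      by_contra hyv
      exact hcon ⟨fun h => absurd h hyv, h2⟩
    exact ⟨hyv, h1 hyv⟩
  obtain ⟨Qs', hQs', hlE, hform⟩ := hB.exists_uncrossed hPs hQs hy hlast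
  rw [← hlE] at h
  have hxy : x ≠ y := by
    rintro rfl
    exact hx hy
  obtain ⟨C, hxC, hrC, hyC, hCentry, hCafter⟩ := exists_separated_set hQs' (hBr hy) hxy h
  have hCr : ∀ {b}, b ∈ C → b ≠ r := by
    rintro b hb rfl
    exact hrC hb
  have hoff : ∀ Q ∈ Qs', ∀ b p q, b ∉ B → Q.verts = p ++ b :: q →
      ∃ P ∈ Ps, ∃ t e W' Y, P.verts = p ++ b :: (t ++ e :: W') ∧ Q.verts = p ++ b :: (t ++ e :: Y) ∧
        (∀ w ∈ p ++ b :: t, w ∉ B) ∧ e ∈ B := by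
    intro Q hQ b p q hb eQ
    obtain ⟨P, hP, W, e, W', Y, eP, eQ', hW, hY⟩ := hform Q hQ
    have hbW : b ∈ W := by
      have : b ∈ Q.verts := by simp [eQ]
      rw [eQ', List.mem_append] at this
      exact this.resolve_right fun h => hb (hY b h)
    obtain ⟨s, t, rfl⟩ := List.mem_iff_append.1 hbW
    have hn := Q.nodup
    rw [eQ] at hn
    obtain ⟨rfl, -⟩ := eq_of_append_cons_eq_of_nodup (p' := s) (q' := t ++ e :: Y)
      (by rw [← eQ, eQ']; simp) hn
    exact ⟨P, hP, t, e, W', Y, by simp [eP], by simp [eQ'], hW, hY e (by simp)⟩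
  have htight : IsTight G r v Ps (B ∪ C) := by
    refine ⟨fun h => h.elim hB.root_not_mem hrC, .inl hB.target_mem, ?_⟩
    intro a b hab ha hb
    have haB : a ∉ B := fun h => ha (.inl h)
    have haC : a ∉ C := fun h => ha (.inr h)
    have hay : a ≠ y := by
      rintro rfl
      exact haB hy
    by_cases hbB : b ∈ B
    · obtain ⟨h1, P, hP, K, K', eP, hK⟩ := hB.entry a b hab haB hbB
      refine ⟨h1, P, hP, K, K', eP, ?_⟩
      rintro z hz (hzB | hzC)
      · exact hK z hz hzB
      have hPl := isPath_iff.1 (hPs.1 P hP)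
      have hKhead : K.head? = some r := by
        have := hPl.head
        rwa [eP, List.head?_append_of_ne_nil _ (List.ne_nil_of_mem hz)] at this
      obtain ⟨k, c, d, k', eK, hkC, hdC⟩ := exists_first_entry hKhead hrC ⟨z, hz, hzC⟩
      have hcB : c ∉ B := hK c (by simp [eK])
      have hdB : d ∉ B := hK d (by simp [eK])
      have hcy : c ≠ y := by
        rintro rfl
        exact hcB hy
      have hcd : (c, d) ∈ G := hPl.rel_of_eq (p := k) (q := k' ++ b :: K') (by simp [eP, eK])
      obtain ⟨Q, hQ, U, U', eQ, hU⟩ := hCentry c d hcd (hkC c (by simp)) hcy hdC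
      obtain ⟨P', hP', t, e, W', Y, eP', eQ', hW, he⟩ := hoff Q hQ d U U' hdB eQ
      have hdv : d ≠ v := by
        rintro rfl
        exact hdB hB.target_mem
      obtain rfl := hPs.eq_of_mem hP hP' (c := d) (by simp [eP, eK]) (by simp [eP']) (hCr hdC) hdv
      obtain ⟨hKe, rfl, -⟩ := eq_of_append_cons_eq (p' := U ++ d :: t) (q' := W')
        (by rw [← eP, eP']; simp) hK hW hbB he
      have eQK : Q.verts = K ++ b :: Y := by simp [eQ', hKe]
      by_cases hby : b = y
      · subst hby
        obtain ⟨rfl, -⟩ := hlast a hab haB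
        obtain rfl := hB.eq_singleton hPs hP eP hK
        obtain rfl : z = r := by simpa using hz
        exact hrC hzC
      · by_cases hbC : b ∈ C
        · obtain ⟨Q', hQ', p, q, eQ'', hp⟩ := hCentry a b hab haC hay hbC
          obtain rfl := hQs'.eq_of_mem hQ hQ' (c := b) (by simp [eQK]) (by simp [eQ'']) (hBr hbB)
            hby
          have hn := Q.nodup
          rw [eQK] at hn
          obtain ⟨rfl, -⟩ := eq_of_append_cons_eq_of_nodup (eQK.symm.trans eQ'') hn
          exact hp z hz hzC
        · exact hCafter Q hQ K b Y eQK hbC hby z hz hzC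
    · have hbC : b ∈ C := hb.resolve_left hbB
      have hbv : b ≠ v := by
        rintro rfl
        exact hbB hB.target_mem
      obtain ⟨Q, hQ, p, q, eQ, hp⟩ := hCentry a b hab haC hay hbC
      obtain ⟨P, hP, t, e, W', Y, eP, -, hW, -⟩ := hoff Q hQ b p q hbB eQ
      refine ⟨fun h => absurd h hbv, P, hP, p, _, eP, ?_⟩
      rintro w hw (hwB | hwC)
      · exact hW w (by simp [hw]) hwB
      · exact hp w hw hwC
  exact hx (hmax _ htight (.inr hxC))

end Uncrossing

/-- If for every edge `uv ∈ D∖G` there is an `I ∈ 𝒢_G(v)` with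
`I + uv ∉ 𝒢_{G+uv}(v)`, then every `G`-vertex-large `H` is `D`-vertex-large. -/
theorem superlarge {V : Type u} [Infinite V] (r : V) (D G : Set (V × V))
    (hroot : IsRooted D r) (hGD : G ⊆ D)
    (h : ∀ u v, (u, v) ∈ D \ G →
      ∃ I ∈ GSet G r v, I ∪ {(u, v)} ∉ GSet (G ∪ {(u, v)}) r v) :
    ∀ H, IsLarge G H r → IsLarge D H r := by
  rintro H ⟨hHG, hH⟩
  refine ⟨hHG.trans hGD, fun v hv => ?_⟩
  obtain ⟨Ps, hE, hPsH⟩ := hH v hv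
  have hB : IsTight G r v Ps (⋃₀ {B | IsTight G r v Ps B}) :=
    isTight_sUnion hE.1 (hE.exists_isTight hv) fun _ hB => hB
  refine ⟨Ps, IsTight.eMSystem (hE.1.mono hGD) ⟨hB.root_not_mem, hB.target_mem, ?_⟩, hPsH⟩
  intro x y hxy hx hy
  by_cases hG : (x, y) ∈ G
  · exact hB.entry x y hG hx hy
  · obtain ⟨_, ⟨Qs, hQs, rfl⟩, hI⟩ := h x y ⟨hxy, hG⟩
    exact hB.entry_of_not_mem_GSet hE.1 (fun _ h => Set.subset_sUnion_of_mem h) hx hy hQs hI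

end FlamePaper
end

section
/- Let D be a rooted digraph with root r and let X ⊆ V−r be finite. Suppose there is an r-fan P in D whose set of last vertices is X. If L is D-vertex-large, then there is an r-fan Q in L whose set of last vertices is X. -/
namespace FlamePaper

universe u
variable {V : Type u}

namespace DiPath

theorem mem_edges_iff (P : DiPath V) (a b : V) :
    (a, b) ∈ P.edges ↔
      ∃ (i : ℕ) (h : i + 1 < P.verts.length), P.verts[i] = a ∧ P.verts[i + 1] = b := by
  unfold edges
  rw [Set.mem_ofPred_eq, List.mem_iff_getElem]
  constructor
  · rintro ⟨i, hi, h⟩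
    have hi' : i + 1 < P.verts.length := by
      simp only [List.length_zip, List.length_tail] at hi
      omega
    refine ⟨i, hi', ?_⟩
    simpa [List.getElem_zip, List.getElem_tail] using h
  · rintro ⟨i, hi, rfl, rfl⟩
    refine ⟨i, ?_, ?_⟩
    · simp only [List.length_zip, List.length_tail]
      omega
    · simp [List.getElem_zip, List.getElem_tail]

theorem length_pos (P : DiPath V) : 0 < P.verts.length := List.length_pos_of_ne_nil P.ne

theorem getElem_zero_eq_first (P : DiPath V) : P.verts[0]'P.length_pos = P.first :=
  (List.head_eq_getElem P.ne).symm

theorem getElem_length_sub_one_eq_last (P : DiPath V) :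
    P.verts[P.verts.length - 1]'(Nat.sub_lt P.length_pos one_pos) = P.last :=
  (List.getLast_eq_getElem P.ne).symm

theorem first_mem (P : DiPath V) : P.first ∈ P.vertexSet := List.head_mem P.ne

theorem last_mem (P : DiPath V) : P.last ∈ P.vertexSet := List.getLast_mem P.ne

theorem source_mem {P : DiPath V} {a b : V} (h : (a, b) ∈ P.edges) : a ∈ P.vertexSet := by
  obtain ⟨i, hi, rfl, rfl⟩ := (P.mem_edges_iff _ _).1 h
  exact List.getElem_mem _

theorem target_mem {P : DiPath V} {a b : V} (h : (a, b) ∈ P.edges) : b ∈ P.vertexSet := by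
  obtain ⟨i, hi, rfl, rfl⟩ := (P.mem_edges_iff _ _).1 h
  exact List.getElem_mem _

theorem target_ne_first {P : DiPath V} {a b : V} (h : (a, b) ∈ P.edges) : b ≠ P.first := by
  obtain ⟨i, hi, rfl, rfl⟩ := (P.mem_edges_iff _ _).1 h
  rw [← P.getElem_zero_eq_first, Ne, P.nodup.getElem_inj_iff]
  omega

theorem source_ne_last {P : DiPath V} {a b : V} (h : (a, b) ∈ P.edges) : a ≠ P.last := by
  obtain ⟨i, hi, rfl, rfl⟩ := (P.mem_edges_iff _ _).1 h
  rw [← P.getElem_length_sub_one_eq_last, Ne, P.nodup.getElem_inj_iff]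
  omega

theorem source_unique {P : DiPath V} {a a' b : V} (h : (a, b) ∈ P.edges)
    (h' : (a', b) ∈ P.edges) : a = a' := by
  obtain ⟨i, hi, rfl, rfl⟩ := (P.mem_edges_iff _ _).1 h
  obtain ⟨j, hj, rfl, hij⟩ := (P.mem_edges_iff _ _).1 h'
  rw [P.nodup.getElem_inj_iff] at hij ⊢
  omega

theorem exists_edge_of_ne_last {P : DiPath V} {a : V} (h : a ∈ P.vertexSet) (ha : a ≠ P.last) :
    ∃ b, (a, b) ∈ P.edges := by
  obtain ⟨i, hi, rfl⟩ := List.mem_iff_getElem.1 h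
  rw [← P.getElem_length_sub_one_eq_last, Ne, P.nodup.getElem_inj_iff] at ha
  exact ⟨P.verts[i + 1]'(by omega), (P.mem_edges_iff _ _).2 ⟨i, by omega, rfl, rfl⟩⟩

theorem exists_edge_of_ne_first {P : DiPath V} {b : V} (h : b ∈ P.vertexSet) (hb : b ≠ P.first) :
    ∃ a, (a, b) ∈ P.edges := by
  obtain ⟨i, hi, rfl⟩ := List.mem_iff_getElem.1 h
  rw [← P.getElem_zero_eq_first, Ne, P.nodup.getElem_inj_iff] at hb
  obtain ⟨j, rfl⟩ := Nat.exists_eq_succ_of_ne_zero hb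
  exact ⟨P.verts[j], (P.mem_edges_iff _ _).2 ⟨j, hi, rfl, rfl⟩⟩

/-- A path that is outside `B` at position `i` and ends in `B` enters `B` after position `i`. -/
theorem exists_enter (P : DiPath V) (B : Set V) (hlast : P.last ∈ B) (i : ℕ)
    (hi : i < P.verts.length) (hiB : P.verts[i] ∉ B) :
    ∃ (k : ℕ) (hk : k + 1 < P.verts.length), i ≤ k ∧ P.verts[k] ∉ B ∧ P.verts[k + 1] ∈ B := by
  by_contra! hcon
  have key : ∀ n, ∀ h : i + n < P.verts.length, P.verts[i + n] ∉ B := by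
    intro n
    induction n with
    | zero => exact fun _ => hiB
    | succ n ih => exact fun h => hcon (i + n) h (by omega) (ih (by omega))
  refine key (P.verts.length - 1 - i) (by omega) ?_
  rw [← P.getElem_length_sub_one_eq_last] at hlast
  convert hlast using 2
  omega

/-- Extension of a path by one edge leading to a new vertex. -/
theorem exists_snoc {D : Set (V × V)} {P : DiPath V} (hP : IsPathIn D P) {c : V}
    (hc : (P.last, c) ∈ D) (hcP : c ∉ P.vertexSet) :
    ∃ Q, IsPath D P.first c Q := by
  refine ⟨⟨P.verts ++ [c], by simp, ?_⟩, ?_, ?_, ?_⟩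
  · refine List.nodup_append.2 ⟨P.nodup, by simp, ?_⟩
    rintro a ha b hb rfl
    exact hcP (List.mem_singleton.1 hb ▸ ha)
  · rintro ⟨a, b⟩ h
    obtain ⟨i, hi, rfl, rfl⟩ := (mem_edges_iff _ _ _).1 h
    simp only [List.length_append, List.length_singleton] at hi
    by_cases h' : i + 1 < P.verts.length
    · rw [List.getElem_append_left h', List.getElem_append_left (by omega)]
      exact hP ((P.mem_edges_iff _ _).2 ⟨i, h', rfl, rfl⟩)
    · rw [List.getElem_append_left (by omega), List.getElem_append_right (by omega)]
      rw [← P.getElem_length_sub_one_eq_last] at hc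
      convert hc using 2
      · congr 1; omega
      · simp
  · simp [first, List.head_append_of_ne_nil P.ne]
  · simp [last]

/-- The initial segment of a path up to one of its vertices. -/
theorem exists_initial_segment {D : Set (V × V)} {P : DiPath V} (hP : IsPathIn D P) {c : V}
    (hc : c ∈ P.vertexSet) : ∃ Q, IsPath D P.first c Q := by
  obtain ⟨i, hi, rfl⟩ := List.mem_iff_getElem.1 hc
  have hne : P.verts.take (i + 1) ≠ [] := by
    simp [P.ne]
  refine ⟨⟨P.verts.take (i + 1), hne, P.nodup.sublist (List.take_sublist _ _)⟩, ?_, ?_, ?_⟩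
  · rintro ⟨a, b⟩ h
    obtain ⟨j, hj, rfl, rfl⟩ := (mem_edges_iff _ _ _).1 h
    simp only [List.length_take] at hj
    refine hP ((P.mem_edges_iff _ _).2 ⟨j, by omega, ?_, ?_⟩) <;> simp
  · simp only [first, List.head_eq_getElem, List.getElem_take]
  · simp only [last, List.getLast_eq_getElem, List.length_take, List.getElem_take]
    congr 1
    omega

end DiPath

theorem exists_isPath_of_reflTransGen {D : Set (V × V)} {a b : V}
    (h : Relation.ReflTransGen (fun x y => (x, y) ∈ D) a b) : ∃ P, IsPath D a b P := by
  induction h with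
  | refl =>
    refine ⟨⟨[a], by simp, by simp⟩, ?_, rfl, rfl⟩
    simp [IsPathIn, DiPath.edges]
  | @tail b c _ hbc ih =>
    obtain ⟨P, hP, rfl, rfl⟩ := ih
    by_cases hc : c ∈ P.vertexSet
    · exact DiPath.exists_initial_segment hP hc
    · exact DiPath.exists_snoc hP hbc hc

/-- `f` assigns to each vertex either itself or an in-neighbour, moving only finitely many
vertices, such that no vertex other than `r` is a value twice and no vertex of `X` is a value.
The orbits of `X` under `f`, read backwards, are the paths of an `r`-fan onto `X`. -/
structure IsPredMap (L : Set (V × V)) (r : V) (X : Set V) (f : V → V) : Prop where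
  root : f r = r
  step : ∀ v, f v = v ∨ (f v, v) ∈ L
  finite : {v | f v ≠ v}.Finite
  inj : ∀ v v', f v = f v' → f v ≠ r → v = v'
  avoid : ∀ v, f v ∉ X

theorem IsPredMap.iterate_sub {L : Set (V × V)} {r : V} {X : Set V} {f : V → V}
    (hf : IsPredMap L r X f) (x y : V) (j : ℕ) :
    ∀ i, f^[i] x = f^[i + j] y → f^[i] x ≠ r → x = f^[j] y := by
  intro i
  induction i with
  | zero => intro h _; simpa using h
  | succ i ih =>
    intro h hr
    rw [Nat.add_right_comm] at h
    rw [Function.iterate_succ_apply'] at hr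
    rw [Function.iterate_succ_apply', Function.iterate_succ_apply'] at h
    refine ih (hf.inj _ _ h hr) ?_
    intro h0
    rw [h0, hf.root] at hr
    exact hr rfl

theorem IsPredMap.exists_iterate_eq_root {L : Set (V × V)} {r : V} {X : Set V} {f : V → V}
    (hf : IsPredMap L r X f) {x : V} (hx : x ∈ X) : ∃ n, f^[n] x = r := by
  by_contra! hcon
  have hlt : ∀ i j, i < j → f^[i] x ≠ f^[j] x := by
    intro i j hij h
    obtain ⟨d, rfl⟩ := Nat.exists_eq_add_of_lt hij
    have := hf.iterate_sub x x (d + 1) i h (hcon i)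
    rw [Function.iterate_succ_apply'] at this
    exact hf.avoid _ (this ▸ hx)
  have hinj : Function.Injective fun i => f^[i] x := by
    intro i j h
    rcases lt_trichotomy i j with h' | h' | h'
    · exact absurd h (hlt i j h')
    · exact h'
    · exact absurd h.symm (hlt j i h')
  refine Set.infinite_range_of_injective hinj (hf.finite.subset ?_)
  rintro _ ⟨i, rfl⟩
  have := (hlt i (i + 1) (Nat.lt_succ_self i)).symm
  rwa [Function.iterate_succ_apply'] at this

theorem IsPredMap.exists_isRFan {L : Set (V × V)} {r : V} {X : Set V} {f : V → V}
    (hf : IsPredMap L r X f) : ∃ Qs, IsRFan L r Qs ∧ Vlast Qs = X := by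
  have hreach : ∀ n x, f^[n] x = r →
      Relation.ReflTransGen (fun a b => (a, b) ∈ {e : V × V | e ∈ L ∧ e.1 = f e.2}) r x := by
    intro n
    induction n with
    | zero => rintro x rfl; exact .refl
    | succ n ih =>
      intro x h
      have h' := ih (f x) h
      rcases hf.step x with hx | hx
      · rwa [hx] at h'
      · exact h'.tail ⟨hx, rfl⟩
  have hpath : ∀ x : X, ∃ P, IsPath {e : V × V | e ∈ L ∧ e.1 = f e.2} r x P := by
    intro x
    obtain ⟨n, hn⟩ := hf.exists_iterate_eq_root x.2
    exact exists_isPath_of_reflTransGen (hreach n x hn)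
  choose P hP hfirst hlast using hpath
  have hiter : ∀ x v, v ∈ (P x).vertexSet → ∃ i, v = f^[i] x := by
    intro x v hv
    obtain ⟨i, hi, rfl⟩ := List.mem_iff_getElem.1 hv
    have key : ∀ n, ∀ h : i + n < (P x).verts.length,
        (P x).verts[i] = f^[n] ((P x).verts[i + n]) := by
      intro n
      induction n with
      | zero => exact fun _ => rfl
      | succ n ih =>
        intro h
        have := (hP x (((P x).mem_edges_iff _ _).2 ⟨i + n, h, rfl, rfl⟩)).2
        rw [ih (by omega), Function.iterate_succ_apply]
        exact congrArg _ this
    refine ⟨(P x).verts.length - 1 - i, ?_⟩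
    rw [key ((P x).verts.length - 1 - i) (by omega), ← hlast x,
      ← (P x).getElem_length_sub_one_eq_last]
    congr 2
    omega
  have hdisj : ∀ (x y : X) i j, i ≤ j → f^[i] (x : V) = f^[j] (y : V) → f^[i] (x : V) ≠ r →
      x = y := by
    intro x y i j hij h hr
    obtain ⟨d, rfl⟩ := Nat.exists_eq_add_of_le hij
    have := hf.iterate_sub _ _ d i h hr
    cases d with
    | zero => exact Subtype.ext this
    | succ d =>
      rw [Function.iterate_succ_apply'] at this
      exact absurd x.2 (this ▸ hf.avoid _)
  refine ⟨Set.range P, ⟨?_, ?_⟩, ?_⟩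
  · rintro _ ⟨x, rfl⟩
    exact ⟨fun e he => (hP x he).1, hfirst x⟩
  · rintro _ ⟨x, rfl⟩ _ ⟨y, rfl⟩ hne
    have hxy : x ≠ y := fun h => hne (h ▸ rfl)
    ext v
    constructor
    · rintro ⟨hvx, hvy⟩
      by_contra hvr
      obtain ⟨i, hi⟩ := hiter x v hvx
      obtain ⟨j, hj⟩ := hiter y v hvy
      have hvr : v ≠ r := hvr
      rcases le_total i j with h | h
      · exact hxy (hdisj x y i j h (hi ▸ hj) (hi ▸ hvr))
      · exact hxy (hdisj y x j i h (hj ▸ hi) (hj ▸ hvr)).symm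
    · rintro rfl
      exact ⟨hfirst x ▸ (P x).first_mem, hfirst y ▸ (P y).first_mem⟩
  · ext v
    constructor
    · rintro ⟨_, ⟨x, rfl⟩, rfl⟩
      exact hlast x ▸ x.2
    · exact fun hv => ⟨_, ⟨⟨v, hv⟩, rfl⟩, hlast ⟨v, hv⟩⟩

/-- The alternating step relation of a predecessor map: the value `y` of `f` at some vertex may
be exchanged for `y'` there. -/
def altStep (L : Set (V × V)) (r : V) (X : Set V) (f : V → V) : Set (V × V) :=
  {e | e.1 ≠ r ∧ e.2 ∉ X ∧ ∃ v, f v = e.1 ∧ (e.2 = v ∨ (e.2, v) ∈ L)}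

open Classical in
theorem IsPredMap.exists_augment {L : Set (V × V)} {r : V} {X : Set V} {f : V → V}
    (hf : IsPredMap L r X f) {x : V} (hxr : x ≠ r) {P : DiPath V}
    (hP : IsPathIn (altStep L r X f) P) (hfirst : P.first = x)
    (hfree : P.last = r ∨ ∀ v, f v ≠ P.last) :
    ∃ g, IsPredMap L r (insert x X) g := by
  obtain ⟨σ, hmove, hfix⟩ : ∃ σ : V → V, (∀ y, (∃ z, (y, z) ∈ P.edges) → (y, σ y) ∈ P.edges) ∧
      ∀ y, (¬∃ z, (y, z) ∈ P.edges) → σ y = y := by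
    refine ⟨fun y => if h : ∃ z, (y, z) ∈ P.edges then h.choose else y, ?_, ?_⟩
    · intro y h
      simp only [dif_pos h]
      exact h.choose_spec
    · intro y h
      simp only [dif_neg h]
  have hmixed : ∀ v v', (f v, σ (f v)) ∈ P.edges → (¬∃ z, (f v', z) ∈ P.edges) →
      f v' = σ (f v) → f v' = r := by
    intro v v' h h' heq
    have hl : f v' = P.last := by
      by_contra hne
      exact h' (DiPath.exists_edge_of_ne_last (heq ▸ DiPath.target_mem h) hne)
    rcases hfree with h0 | h0
    · exact hl.trans h0
    · exact absurd hl (h0 v')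
  refine ⟨σ ∘ f, ⟨?_, ?_, ?_, ?_, ?_⟩⟩
  · change σ (f r) = r
    rw [hf.root]
    exact hfix r fun ⟨z, hz⟩ => (hP hz).1 rfl
  · intro v
    change σ (f v) = v ∨ (σ (f v), v) ∈ L
    by_cases h : ∃ z, (f v, z) ∈ P.edges
    · obtain ⟨h1, -, v', hv', h2⟩ := hP (hmove _ h)
      obtain rfl := hf.inj _ _ hv' (hv' ▸ h1)
      exact h2
    · rw [hfix _ h]
      exact hf.step v
  · have hfinP : P.vertexSet.Finite := List.finite_toSet P.verts
    refine (hf.finite.union hfinP).subset ?_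
    intro v hv
    by_contra hcon
    rw [Set.mem_union, not_or] at hcon
    have hfv : f v = v := by simpa using hcon.1
    apply hv
    change σ (f v) = v
    rw [hfv]
    exact hfix v fun ⟨z, hz⟩ => hcon.2 (DiPath.source_mem hz)
  · intro v v' h hr
    change σ (f v) = σ (f v') at h
    change σ (f v) ≠ r at hr
    by_cases h1 : ∃ z, (f v, z) ∈ P.edges <;> by_cases h2 : ∃ z, (f v', z) ∈ P.edges
    · refine hf.inj _ _ (DiPath.source_unique (hmove _ h1) (h ▸ hmove _ h2)) ?_
      exact (hP (hmove _ h1)).1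
    · have := hmixed v v' (hmove _ h1) h2 ((hfix _ h2).symm.trans h.symm)
      exact absurd (h.trans ((hfix _ h2).trans this)) hr
    · have := hmixed v' v (hmove _ h2) h1 ((hfix _ h1).symm.trans h)
      exact absurd ((hfix _ h1).trans this) hr
    · rw [hfix _ h1, hfix _ h2] at h
      rw [hfix _ h1] at hr
      exact hf.inj _ _ h hr
  · intro v hv
    change σ (f v) ∈ insert x X at hv
    by_cases h : ∃ z, (f v, z) ∈ P.edges
    · rcases hv with hv | hv
      · exact DiPath.target_ne_first (hmove _ h) (hv.trans hfirst.symm)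
      · exact (hP (hmove _ h)).2.1 hv
    · rw [hfix _ h] at hv
      rcases hv with hv | hv
      · have hl : f v = P.last := by
          by_contra hne
          exact h (DiPath.exists_edge_of_ne_last (by rw [hv, ← hfirst]; exact P.first_mem) hne)
        rcases hfree with h0 | h0
        · exact hxr (hv ▸ hl.trans h0)
        · exact h0 v hl
      · exact hf.avoid v hv

/-- If no alternating path of a predecessor map ends in a free vertex, the vertices reached by
alternating paths provide a small cut. -/
theorem IsPredMap.exists_cut {L : Set (V × V)} {r : V} {X : Set V} {f : V → V}
    (hf : IsPredMap L r X f) (hXr : r ∉ X) {Z : Set V} (hZr : r ∉ Z)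
    (hZX : ∀ z ∈ Z, ∃ v, f v = z)
    (hZ : ∀ y ∈ Z, ∀ y', (y, y') ∈ altStep L r X f → y' ∈ Z) :
    r ∉ Z ∪ X ∧ (entrance L (Z ∪ X)).encard ≤ X.encard := by
  classical
  refine ⟨fun h => h.elim hZr hXr, ?_⟩
  set W : Set V := {v | f v ∈ Z} with hW
  have hWN : ∀ v ∈ W, ∀ y, (y = v ∨ (y, v) ∈ L) → y ∈ Z ∪ X := by
    intro v hv y hy
    by_cases hyX : y ∈ X
    · exact Or.inr hyX
    · exact Or.inl (hZ (f v) hv y ⟨fun h => hZr (h ▸ hv), hyX, v, rfl, hy⟩)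
  have hent : entrance L (Z ∪ X) ⊆ (Z \ W) ∪ (X \ W) := by
    rintro v ⟨hv, u, hu, huv⟩
    have hvW : v ∉ W := fun h => hu (hWN v h u (Or.inr huv))
    exact hv.imp (⟨·, hvW⟩) (⟨·, hvW⟩)
  have hEfin : (W ∩ {v | f v ≠ v}).Finite := hf.finite.inter_of_right _
  have hinj : Set.InjOn f (W ∩ {v | f v ≠ v}) := fun v hv v' _ h =>
    hf.inj v v' h fun h0 => hZr (h0 ▸ hv.1)
  have hcard : (hEfin.toFinset.image f).card = hEfin.toFinset.card :=
    Finset.card_image_of_injOn (by simpa using hinj)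
  have hsd := Finset.card_sdiff_comm hcard
  have h1 : Z \ W ⊆ ((hEfin.toFinset.image f \ hEfin.toFinset : Finset V) : Set V) := by
    rintro z ⟨hz, hzW⟩
    obtain ⟨v, rfl⟩ := hZX z hz
    have hne : f v ≠ v := fun h => hzW (show f (f v) ∈ Z by rw [h]; exact hz)
    have hvW : v ∈ W := hz
    simp only [Finset.coe_sdiff, Finset.coe_image, Set.Finite.coe_toFinset]
    exact ⟨⟨v, ⟨hvW, hne⟩, rfl⟩, fun h => hzW h.1⟩
  have h2 : ((hEfin.toFinset \ hEfin.toFinset.image f : Finset V) : Set V) ⊆ X ∩ W := by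
    intro v hv
    simp only [Finset.coe_sdiff, Finset.coe_image, Set.Finite.coe_toFinset] at hv
    obtain ⟨⟨hvW, hne⟩, hni⟩ := hv
    refine ⟨(hWN v hvW v (Or.inl rfl)).resolve_left fun hvZ => hni ?_, hvW⟩
    obtain ⟨u, hu⟩ := hZX v hvZ
    refine ⟨u, ⟨show f u ∈ Z from hu ▸ hvZ, fun h => ?_⟩, hu⟩
    obtain rfl : u = v := h.symm.trans hu
    exact hne hu
  calc (entrance L (Z ∪ X)).encard ≤ ((Z \ W) ∪ (X \ W)).encard := Set.encard_le_encard hent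
    _ ≤ (Z \ W).encard + (X \ W).encard := Set.encard_union_le _ _
    _ ≤ (X ∩ W).encard + (X \ W).encard := by
      refine add_le_add_left ?_ _
      refine (Set.encard_le_encard h1).trans (le_trans ?_ (Set.encard_le_encard h2))
      rw [Set.encard_coe_eq_coe_finsetCard, Set.encard_coe_eq_coe_finsetCard, hsd]
    _ = X.encard := by rw [add_comm, Set.encard_sdiff_add_encard_inter]

/-- Menger's theorem for fans onto a finite set in an arbitrary digraph. -/
theorem exists_isPredMap_or_cut (L : Set (V × V)) (r : V) {X : Set V} (hX : X.Finite)
    (hXr : r ∉ X) :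
    (∃ f, IsPredMap L r X f) ∨
      ∃ B, X ⊆ B ∧ r ∉ B ∧ (entrance L B).encard < X.encard := by
  induction X, hX using Set.Finite.induction_on with
  | empty => exact Or.inl ⟨id, rfl, fun _ => Or.inl rfl, by simp, fun _ _ h _ => h, by simp⟩
  | @insert x X hxX hX ih =>
    have hxr : x ≠ r := fun h => hXr (h ▸ Set.mem_insert x X)
    have hXr' : r ∉ X := fun h => hXr (Set.mem_insert_of_mem _ h)
    rcases ih hXr' with ⟨f, hf⟩ | ⟨B, hXB, hrB, hB⟩
    · set Z : Set V :=
        {y | Relation.ReflTransGen (fun a b => (a, b) ∈ altStep L r X f) x y} with hZdef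
      by_cases hfree : ∃ y ∈ Z, y = r ∨ ∀ v, f v ≠ y
      · obtain ⟨y, hy, hfree⟩ := hfree
        obtain ⟨P, hP, hPx, rfl⟩ := exists_isPath_of_reflTransGen hy
        exact Or.inl (hf.exists_augment hxr hP hPx hfree)
      · push Not at hfree
        right
        obtain ⟨h1, h2⟩ := hf.exists_cut hXr' (Z := Z) (fun h => (hfree r h).1 rfl)
          (fun z hz => (hfree z hz).2) (fun y hy y' h => Relation.ReflTransGen.tail hy h)
        refine ⟨Z ∪ X, Set.insert_subset (Or.inl .refl) Set.subset_union_right, h1,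
          lt_of_le_of_lt h2 ?_⟩
        rw [Set.encard_insert_of_notMem hxX]
        exact ENat.lt_add_one_iff hX.encard_lt_top.ne |>.2 le_rfl
    · right
      refine ⟨insert x B, Set.insert_subset_insert hXB, ?_, ?_⟩
      · rintro (h | h)
        · exact hxr h.symm
        · exact hrB h
      · have hsub : entrance L (insert x B) ⊆ insert x (entrance L B) := by
          rintro v ⟨hv, u, hu, huv⟩
          exact hv.imp id fun h => ⟨h, u, fun h' => hu (Or.inr h'), huv⟩
        rw [Set.encard_insert_of_notMem hxX]
        calc _ ≤ (insert x (entrance L B)).encard := Set.encard_le_encard hsub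
          _ ≤ (entrance L B).encard + 1 := Set.encard_insert_le _ _
          _ < X.encard + 1 := by
            exact (ENat.add_lt_add_iff_right (by simp)).2 hB

/-- Sets with fewer than `n` entrance vertices are closed under unions of chains. -/
theorem encard_entrance_sUnion_lt {L : Set (V × V)} {n : ℕ} {c : Set (Set V)}
    (hc : IsChain (· ⊆ ·) c) (hne : c.Nonempty)
    (h : ∀ B ∈ c, (entrance L B).encard < n) : (entrance L (⋃₀ c)).encard < n := by
  by_contra! hcon
  obtain ⟨t, ht, htn⟩ := Set.exists_subset_encard_eq hcon
  have htfin : t.Finite := Set.finite_of_encard_eq_coe htn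
  obtain ⟨B, hB, htB⟩ := DirectedOn.exists_mem_subset_of_finite_of_subset_sUnion hne hc.directedOn
    htfin (fun v hv => (ht hv).1)
  refine (h B hB).not_ge (htn ▸ Set.encard_le_encard fun v hv => ⟨htB hv, ?_⟩)
  obtain ⟨-, u, hu, huv⟩ := ht hv
  exact ⟨u, fun h' => hu ⟨B, hB, h'⟩, huv⟩

/-- If `rw` is no edge, the Erdős–Menger selection for `w` can be made among internal vertices. -/
theorem EMSystem.exists_internal_sel {D L : Set (V × V)} {r w : V} {Ps : Set (DiPath V)}
    (h : EMSystem D r w Ps) (hL : LiesIn Ps L) (hrw : (r, w) ∉ L) :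
    ∃ t : DiPath V → V, (∀ P ∈ Ps, t P ∈ P.vertexSet ∧ t P ≠ r ∧ t P ≠ w) ∧
      ∀ Q : DiPath V, IsPath D r w Q → ∃ P ∈ Ps, t P ∈ Q.vertexSet := by
  obtain ⟨⟨hpaths, -⟩, sel, hsel, hmeet⟩ := h
  have hex : ∀ P, ∃ t, P ∈ Ps → (t ∈ P.vertexSet ∧ t ≠ r ∧ t ≠ w) ∧
      ∀ Q : DiPath V, (∀ x, sel P = Sum.inl x → x ∈ Q.vertexSet) →
        (∀ e, sel P = Sum.inr e → e ∈ Q.edges) → t ∈ Q.vertexSet := by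
    intro P
    by_cases hP : P ∈ Ps
    swap
    · exact ⟨r, fun h => absurd h hP⟩
    obtain ⟨-, hfirst, hlast⟩ := hpaths P hP
    cases hs : sel P with
    | inl x =>
      have hx := (hsel P hP).1 x hs
      rw [DiPath.internal, hfirst, hlast] at hx
      refine ⟨x, fun _ => ⟨⟨hx.1, fun h => hx.2 (Or.inl h), fun h => hx.2 (Or.inr h)⟩, ?_⟩⟩
      exact fun Q hQ _ => hQ x rfl
    | inr e =>
      obtain ⟨a, b⟩ := e
      have he := (hsel P hP).2 _ hs
      by_cases hb : b = w
      · subst hb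
        refine ⟨a, fun _ => ⟨⟨DiPath.source_mem he, ?_, ?_⟩, ?_⟩⟩
        · rintro rfl
          exact hrw (hL P hP he)
        · exact hlast ▸ DiPath.source_ne_last he
        · exact fun Q _ hQ => DiPath.source_mem (hQ _ rfl)
      · refine ⟨b, fun _ => ⟨⟨DiPath.target_mem he, ?_, hb⟩, ?_⟩⟩
        · exact hfirst ▸ DiPath.target_ne_first he
        · exact fun Q _ hQ => DiPath.target_mem (hQ _ rfl)
  choose t ht using hex
  refine ⟨t, fun P hP => (ht P hP).1, fun Q hQ => ?_⟩
  obtain ⟨P, hP, h1, h2⟩ := hmeet Q hQ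
  exact ⟨P, hP, (ht P hP).2 Q h1 h2⟩

/-- A set whose entrance in `D` exceeds its entrance in a `D`-vertex-large `L` can be enlarged
without increasing its entrance in `L`. -/
theorem IsLarge.exists_ssuperset {D L : Set (V × V)} {r : V} (hL : IsLarge D L r) {B : Set V}
    (hrB : r ∉ B) {w : V} (hwD : w ∈ entrance D B) (hwL : w ∉ entrance L B) :
    ∃ B', B ⊂ B' ∧ r ∉ B' ∧ (entrance L B').encard ≤ (entrance L B).encard := by
  obtain ⟨hwB, u, huB, huw⟩ := hwD
  have hnL : ∀ a, a ∉ B → (a, w) ∉ L := fun a ha h => hwL ⟨hwB, a, ha, h⟩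
  have hwr : w ≠ r := fun h => hrB (h ▸ hwB)
  obtain ⟨Ps, hEM, hPL⟩ := hL.2 w hwr
  obtain ⟨t, ht, hmeet⟩ := hEM.exists_internal_sel hPL (hnL r hrB)
  have hpath := hEM.1.1
  have hdisj := hEM.1.2
  set T : Set V := t '' Ps with hT
  have hrT : r ∉ T := by
    rintro ⟨P, hP, h⟩
    exact (ht P hP).2.1 h
  have hwT : w ∉ T := by
    rintro ⟨P, hP, h⟩
    exact (ht P hP).2.2 h
  have hTP : ∀ P ∈ Ps, ∀ v ∈ P.vertexSet, v ∈ T → v = t P := by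
    rintro P hP _ hv ⟨Q, hQ, rfl⟩
    by_contra hne
    have hmem : t Q ∈ Q.vertexSet ∩ P.vertexSet := ⟨(ht Q hQ).1, hv⟩
    rw [hdisj Q hQ P hP (fun h => hne (h ▸ rfl))] at hmem
    exact hmem.elim (ht Q hQ).2.1 (ht Q hQ).2.2
  set A : Set V := {x | ¬Relation.ReflTransGen
    (fun a b => (a, b) ∈ {e : V × V | e ∈ D ∧ e.2 ∉ T}) r x} with hA
  have hrA : r ∉ A := fun h => h .refl
  have hentA : ∀ a b, a ∉ A → b ∈ A → (a, b) ∈ D → b ∈ T := by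
    intro a b ha hb hab
    by_contra hbT
    exact hb ((not_not.1 ha).tail ⟨hab, hbT⟩)
  have hwA : w ∈ A := by
    intro hreach
    obtain ⟨Q, hQ, hQr, hQw⟩ := exists_isPath_of_reflTransGen hreach
    obtain ⟨P, hP, htQ⟩ := hmeet Q ⟨fun e he => (hQ he).1, hQr, hQw⟩
    obtain ⟨a, ha⟩ := DiPath.exists_edge_of_ne_first htQ (hQr ▸ (ht P hP).2.1)
    exact (hQ ha).2 ⟨P, hP, rfl⟩
  have huA : u ∈ A := by
    by_contra h
    exact hwT (hentA u w h hwA huw)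
  refine ⟨B ∪ A, ⟨Set.subset_union_left, fun h => huB (h (Or.inr huA))⟩,
    fun h => h.elim hrB hrA, ?_⟩
  set S := entrance L B with hS
  have hent : entrance L (B ∪ A) ⊆ (S \ (A \ T)) ∪ (T \ B) := by
    rintro v ⟨hv, a, ha, hav⟩
    rw [Set.mem_union, not_or] at ha
    have hvT : v ∈ A → v ∈ T := fun h => hentA a v ha.2 h (hL.1 hav)
    by_cases hvB : v ∈ B
    · exact Or.inl ⟨⟨hvB, a, ha.1, hav⟩, fun h => h.2 (hvT h.1)⟩
    · exact Or.inr ⟨hvT (hv.resolve_left hvB), hvB⟩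
  have hcross : ∀ x, ∃ s, x ∈ T \ B → s ∈ S ∩ (A \ T) ∧
      ∃ P ∈ Ps, t P = x ∧ s ∈ P.vertexSet := by
    intro x
    by_cases hx : x ∈ T \ B
    swap
    · exact ⟨x, fun h => absurd h hx⟩
    obtain ⟨⟨P, hP, hPx⟩, hxB⟩ := hx
    obtain ⟨i, hi, hix⟩ := List.mem_iff_getElem.1 (ht P hP).1
    have hafter : ∀ k (hk : k < P.verts.length), i < k → P.verts[k] ∉ T := by
      intro k hk hik hkT
      have := hTP P hP _ (List.getElem_mem hk) hkT
      rw [← hix, P.nodup.getElem_inj_iff] at this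
      omega
    have hlast := (hpath P hP).2.2
    obtain ⟨k, hk, hik, hkB, hkB'⟩ := P.exists_enter B (hlast ▸ hwB) i hi
      (by rw [hix, hPx]; exact hxB)
    refine ⟨P.verts[k + 1], fun _ => ⟨⟨⟨hkB', P.verts[k], hkB, ?_⟩, ?_, ?_⟩,
      P, hP, hPx, List.getElem_mem hk⟩⟩
    · exact hPL P hP ((P.mem_edges_iff _ _).2 ⟨k, hk, rfl, rfl⟩)
    · by_contra hkA
      obtain ⟨m, hm, hkm, hmA, hmA'⟩ := P.exists_enter A (hlast ▸ hwA) (k + 1) hk hkA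
      refine hafter (m + 1) hm (by omega) (hentA _ _ hmA hmA' ?_)
      exact (hpath P hP).1 ((P.mem_edges_iff _ _).2 ⟨m, hm, rfl, rfl⟩)
    · exact hafter (k + 1) hk (by omega)
  choose s hs using hcross
  have hinj : Set.InjOn s (T \ B) := by
    intro x hx y hy hxy
    obtain ⟨hsx, P, hP, rfl, hsP⟩ := hs x hx
    obtain ⟨-, Q, hQ, rfl, hsQ⟩ := hs y hy
    by_contra hne
    have hmem : s (t P) ∈ P.vertexSet ∩ Q.vertexSet := ⟨hsP, hxy ▸ hsQ⟩
    rw [hdisj P hP Q hQ (fun h => hne (h ▸ rfl))] at hmem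
    rcases hmem with h | h
    · exact hrA (h ▸ hsx.2.1)
    · exact hwL (h ▸ hsx.1)
  calc (entrance L (B ∪ A)).encard ≤ ((S \ (A \ T)) ∪ (T \ B)).encard :=
        Set.encard_le_encard hent
    _ ≤ (S \ (A \ T)).encard + (T \ B).encard := Set.encard_union_le _ _
    _ ≤ (S \ (A \ T)).encard + (S ∩ (A \ T)).encard := by
      refine add_le_add_right ?_ _
      exact Set.encard_le_encard_of_injOn (fun x hx => (hs x hx).1) hinj
    _ = S.encard := Set.encard_sdiff_add_encard_inter _ _

theorem IsRFan.encard_Vlast_le_entrance {D : Set (V × V)} {r : V} {Ps : Set (DiPath V)}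
    (hPs : IsRFan D r Ps) {B : Set V} (hrB : r ∉ B) (hB : Vlast Ps ⊆ B) :
    (Vlast Ps).encard ≤ (entrance D B).encard := by
  have hex : ∀ P, ∃ s, P ∈ Ps → s ∈ entrance D B ∧ s ∈ P.vertexSet := by
    intro P
    by_cases hP : P ∈ Ps
    swap
    · exact ⟨r, fun h => absurd h hP⟩
    obtain ⟨hPD, hPr⟩ := hPs.1 P hP
    obtain ⟨k, hk, -, hkB, hkB'⟩ := P.exists_enter B (hB ⟨P, hP, rfl⟩) 0 P.length_pos
      (by rw [P.getElem_zero_eq_first, hPr]; exact hrB)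
    exact ⟨P.verts[k + 1], fun _ => ⟨⟨hkB', P.verts[k], hkB,
      hPD ((P.mem_edges_iff _ _).2 ⟨k, hk, rfl, rfl⟩)⟩, List.getElem_mem hk⟩⟩
  choose s hs using hex
  refine (Set.encard_image_le _ _).trans
    (Set.encard_le_encard_of_injOn (f := s) (fun P hP => (hs P hP).1) ?_)
  intro P hP Q hQ h
  by_contra hne
  have hmem : s P ∈ P.vertexSet ∩ Q.vertexSet := ⟨(hs P hP).2, h ▸ (hs Q hQ).2⟩
  rw [hPs.2 P hP Q hQ hne] at hmem
  exact hrB (hmem ▸ (hs P hP).1.1)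

/-- If a finite `X ⊆ V − r` is the set of last vertices of an `r`-fan of `D` and `L`
is `D`-vertex-large, then `X` is the set of last vertices of an `r`-fan of `L`. -/
theorem reach_finite_preserved {V : Type u} [Infinite V] (r : V) (D L : Set (V × V))
    (hroot : IsRooted D r) (X : Set V) (hXfin : X.Finite) (hXr : r ∉ X)
    (Ps : Set (DiPath V)) (hPs : IsRFan D r Ps) (hlast : Vlast Ps = X)
    (hL : IsLarge D L r) :
    ∃ Qs, IsRFan L r Qs ∧ Vlast Qs = X := by
  rcases exists_isPredMap_or_cut L r hXfin hXr with ⟨f, hf⟩ | ⟨B₀, hB₀⟩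
  · exact hf.exists_isRFan
  exfalso
  obtain ⟨n, hn⟩ : ∃ n : ℕ, X.encard = n := ⟨X.ncard, hXfin.cast_ncard_eq.symm⟩
  rw [hn] at hB₀
  obtain ⟨B, -, ⟨hXB, hrB, hB⟩, hmax⟩ := zorn_subset_nonempty
    {B : Set V | X ⊆ B ∧ r ∉ B ∧ (entrance L B).encard < n} (by
      intro c hc hchain hne
      refine ⟨⋃₀ c, ⟨?_, ?_, ?_⟩, fun s hs => Set.subset_sUnion_of_mem hs⟩
      · obtain ⟨C, hC⟩ := hne
        exact (hc hC).1.trans (Set.subset_sUnion_of_mem hC)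
      · rintro ⟨C, hC, hrC⟩
        exact (hc hC).2.1 hrC
      · exact encard_entrance_sUnion_lt hchain hne fun C hC => (hc hC).2.2) B₀ hB₀
  have hle : X.encard ≤ (entrance D B).encard := by
    have := hPs.encard_Vlast_le_entrance hrB (hlast.trans_subset hXB)
    rwa [hlast] at this
  obtain ⟨w, hwD, hwL⟩ : ∃ w ∈ entrance D B, w ∉ entrance L B := by
    by_contra! hcon
    exact (hB.trans_le (hn ▸ hle)).not_ge (Set.encard_le_encard hcon)
  obtain ⟨B', hBB', hrB', hB'⟩ := hL.exists_ssuperset hrB hwD hwL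
  exact hBB'.2 (hmax ⟨hXB.trans hBB'.1, hrB', hB'.trans_lt hB⟩ hBB'.1)

end FlamePaper
end
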